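/- Let h : K → K be a homeomorphism. Then there exist an integer b and a real number M > 0 such that for every z̄ ∈ K there are an arc A ⊆ K (possibly degenerate) containing both h(z̄) and σ̂^{−b}(z̄) and a natural number m with π_m restricted to A injective and s^m · diam(π_m(A)) ≤ M; in other words, d̄(σ̂^{−b}(z̄), h(z̄)) ≤ M for all z̄ ∈ K. -/

import Mathlib

open Set Filter Topology Function

noncomputable section

/-- The tent map with slope `s`. -/
def tent (s : ℝ) (x : ℝ) : ℝ := min (s * x) (s * (1 - x))

/-- The ω-limit set of `c` under iteration of `f`. -/
def omegaSet (f : ℝ → ℝ) (c : ℝ) : Set ℝ :=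
  {y | ∃ φ : ℕ → ℕ, StrictMono φ ∧ Tendsto (fun k => f^[φ k] c) atTop (𝓝 y)}

/-- The inverse limit space `K = lim←([0,1], T)`, as a subset of `ℕ → ℝ`. -/
def invLim (s : ℝ) : Set (ℕ → ℝ) :=
  {x | (∀ n, x n ∈ Icc (0 : ℝ) 1) ∧ ∀ n, x n = tent s (x (n + 1))}

/-- The `n`-th coordinate projection `π_n : K → [0,1]`. -/
def proj (s : ℝ) (n : ℕ) (x : invLim s) : ℝ := (x : ℕ → ℝ) n

/-- The inverse shift homeomorphism `σ̂⁻¹(x₀,x₁,…) = (x₁,x₂,…)` as a map `K → K`. -/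
def shiftInvFun (s : ℝ) (x : invLim s) : invLim s :=
  ⟨fun n => (x : ℕ → ℝ) (n + 1), fun n => x.2.1 (n + 1), fun n => x.2.2 (n + 1)⟩

/-- The shift homeomorphism `σ̂(x₀,x₁,…) = (T x₀, x₀, x₁, …)` as a map `K → K`. -/
def shiftFwdFun (s : ℝ) (hs1 : Real.sqrt 2 < s) (hs2 : s < 2) (x : invLim s) : invLim s := by
  refine ⟨fun n => Nat.casesOn n (tent s ((x : ℕ → ℝ) 0)) (fun k => (x : ℕ → ℝ) k), ?_, ?_⟩
  · intro n
    cases n with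
    | zero =>
      have hx0 := x.2.1 0
      have hs0 : 0 ≤ s := le_of_lt (lt_of_le_of_lt (Real.sqrt_nonneg 2) hs1)
      constructor
      · exact le_min (mul_nonneg hs0 hx0.1) (mul_nonneg hs0 (by linarith [hx0.2]))
      · rcases le_total ((x : ℕ → ℝ) 0) (1 / 2) with hc | hc
        · exact le_trans (min_le_left _ _) (by nlinarith [hx0.1, hx0.2])
        · exact le_trans (min_le_right _ _) (by nlinarith [hx0.1, hx0.2])
    | succ k => exact x.2.1 k
  · intro n
    cases n with
    | zero => rfl
    | succ k => exact x.2.2 k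

/-- The integer power `σ̂^b` of the shift homeomorphism : for `b ≥ 0` it is the `b`-th iterate
of `σ̂`, and for `b < 0` the `|b|`-th iterate of `σ̂⁻¹`. -/
def shiftZ (s : ℝ) (hs1 : Real.sqrt 2 < s) (hs2 : s < 2) (b : ℤ) : invLim s → invLim s :=
  if 0 ≤ b then (shiftFwdFun s hs1 hs2)^[b.toNat] else (shiftInvFun s)^[(-b).toNat]

/-- The set `F` of folding points of `K`. -/
def foldingPts (s : ℝ) : Set (invLim s) :=
  {x | ∀ n, proj s n x ∈ omegaSet (tent s) (1 / 2)}

/-- The set `E_p` of `p`-points of `K`. -/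
def pPoints (s : ℝ) (p : ℕ) : Set (invLim s) :=
  {x | ∃ n, p < n ∧ proj s n x = 1 / 2}

/-- `A` is an arc with endpoints `a` and `b`. -/
def IsArcWith {X : Type*} [TopologicalSpace X] (A : Set X) (a b : X) : Prop :=
  ∃ f : unitInterval → X, Topology.IsEmbedding f ∧ range f = A ∧ f 0 = a ∧ f 1 = b

/-- `A` is an arc (a homeomorphic copy of `[0,1]`). -/
def IsArc {X : Type*} [TopologicalSpace X] (A : Set X) : Prop :=
  ∃ a b, IsArcWith A a b

/-- `A` is an arc with endpoints `a`, `b`, possibly degenerate (a single point when `a = b`). -/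
def IsArcBtw {X : Type*} [TopologicalSpace X] (A : Set X) (a b : X) : Prop :=
  IsArcWith A a b ∨ (a = b ∧ A = {a})

/-- `A` is an arc, possibly degenerate (i.e. a single point). -/
def IsArcOrPoint {X : Type*} [TopologicalSpace X] (A : Set X) : Prop :=
  IsArc A ∨ ∃ x, A = {x}

/-- The composant of a point `x`: the union of all proper subcontinua containing `x`. -/
def composant {X : Type*} [TopologicalSpace X] (x : X) : Set X :=
  {y | ∃ A : Set X, IsCompact A ∧ IsConnected A ∧ A ≠ univ ∧ x ∈ A ∧ y ∈ A}

/-- `g` preserves the order along composants: for every composant `C` and every continuous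
bijection `φ` from `ℝ` (respectively from `[0,∞)`) onto `C`, the map `φ⁻¹ ∘ g ∘ φ` is strictly
increasing. -/
def PreservesCompOrder {X : Type*} [TopologicalSpace X] (g : X → X) : Prop :=
  ∀ x : X,
    (∀ φ : ℝ → X, Continuous φ → Injective φ → range φ = composant x →
      ∀ t t' u u' : ℝ, g (φ t) = φ u → g (φ t') = φ u' → t < t' → u < u') ∧
    (∀ φ : {r : ℝ // (0 : ℝ) ≤ r} → X, Continuous φ → Injective φ → range φ = composant x →
      ∀ t t' u u', g (φ t) = φ u → g (φ t') = φ u' → t < t' → u < u')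

/-- Two self-maps of `X` are isotopic if there is a continuous `H : X × [0,1] → X` joining them
through homeomorphisms. -/
def Isotopic {X : Type*} [TopologicalSpace X] (f g : X → X) : Prop :=
  ∃ H : X × unitInterval → X, Continuous H ∧ (∀ x, H (x, 0) = f x) ∧ (∀ x, H (x, 1) = g x) ∧
    ∀ t : unitInterval, IsHomeomorph fun x => H (x, t)

/-- The topological limsup of a sequence of subsets. -/
def setLimsup {X : Type*} [TopologicalSpace X] (D : ℕ → Set X) : Set X :=
  {y | ∃ φ : ℕ → ℕ, StrictMono φ ∧ ∃ z : ℕ → X, (∀ k, z k ∈ D (φ k)) ∧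
    Tendsto z atTop (𝓝 y)}

/-- The point `0̄ = (0,0,0,…)` of `K` (an endpoint of `K`). -/
def zeroPt (s : ℝ) (hs1 : Real.sqrt 2 < s) : invLim s := by
  refine ⟨fun _ => 0, fun n => ⟨le_refl 0, zero_le_one⟩, fun n => ?_⟩
  have hs0 : 0 ≤ s := le_of_lt (lt_of_le_of_lt (Real.sqrt_nonneg 2) hs1)
  simp [tent]
  exact hs0

/-! ### Basic facts on the tent map -/

lemma tent_eq {s : ℝ} (hs : 0 < s) (x : ℝ) : tent s x = s / 2 - s * |x - 1 / 2| := by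
  unfold tent
  rcases le_total x (1 / 2) with h | h
  · rw [abs_of_nonpos (by linarith), min_eq_left (by nlinarith)]; ring
  · rw [abs_of_nonneg (by linarith), min_eq_right (by nlinarith)]; ring

lemma tent_sym (s x : ℝ) : tent s (1 - x) = tent s x := by
  unfold tent
  rw [min_comm]; congr 2; ring

lemma tent_left {s : ℝ} (hs : 0 < s) {x : ℝ} (hx : x ≤ 1 / 2) : tent s x = s * x := by
  rw [tent_eq hs, abs_of_nonpos (by linarith)]; ring

lemma tent_right {s : ℝ} (hs : 0 < s) {x : ℝ} (hx : 1 / 2 ≤ x) : tent s x = s * (1 - x) := by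
  rw [tent_eq hs, abs_of_nonneg (by linarith)]; ring

lemma tent_diff {s : ℝ} (hs : 0 < s) (x y : ℝ) :
    |tent s x - tent s y| = s * |(|x - 1 / 2| - |y - 1 / 2|)| := by
  rw [tent_eq hs, tent_eq hs]
  have : s / 2 - s * |x - 1 / 2| - (s / 2 - s * |y - 1 / 2|)
    = -(s * (|x - 1 / 2| - |y - 1 / 2|)) := by ring
  rw [this, abs_neg, abs_mul, abs_of_pos hs]

lemma tent_lip {s : ℝ} (hs : 0 < s) (x y : ℝ) : |tent s x - tent s y| ≤ s * |x - y| := by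
  rw [tent_diff hs]
  apply mul_le_mul_of_nonneg_left _ hs.le
  have := abs_abs_sub_abs_le_abs_sub (x - 1 / 2) (y - 1 / 2)
  simpa using this

lemma tent_iter_lip {s : ℝ} (hs : 0 < s) (n : ℕ) (x y : ℝ) :
    |(tent s)^[n] x - (tent s)^[n] y| ≤ s ^ n * |x - y| := by
  induction n generalizing x y with
  | zero => simp
  | succ n ih =>
    rw [iterate_succ_apply, iterate_succ_apply]
    calc _ ≤ s ^ n * |tent s x - tent s y| := ih _ _
      _ ≤ s ^ n * (s * |x - y|) := by
        apply mul_le_mul_of_nonneg_left (tent_lip hs x y) (by positivity)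
      _ = _ := by ring

lemma tent_cont (s : ℝ) : Continuous (tent s) := by
  unfold tent; fun_prop

lemma tent_mem {s : ℝ} (hs : 0 < s) (hs2 : s < 2) {x : ℝ} (hx : x ∈ Icc (0 : ℝ) 1) :
    tent s x ∈ Icc (0 : ℝ) 1 := by
  obtain ⟨h0, h1⟩ := hx
  rcases le_total x (1 / 2) with h | h
  · rw [tent_left hs h]; constructor <;> nlinarith
  · rw [tent_right hs h]; constructor <;> nlinarith

lemma tent_le {s : ℝ} (hs : 0 < s) (x : ℝ) : tent s x ≤ s / 2 := by
  rw [tent_eq hs]; nlinarith [abs_nonneg (x - 1 / 2)]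

/-- The standing assumptions: slope in `(1,2)`, and the critical orbit stays `ε`-away from `1/2`. -/
structure Ctx (s ε : ℝ) : Prop where
  one_lt : 1 < s
  lt_two : s < 2
  eps_pos : 0 < ε
  away : ∀ n : ℕ, 1 ≤ n → ε ≤ |(tent s)^[n] (1 / 2) - 1 / 2|

namespace Ctx
variable {s ε : ℝ}

lemma pos (C : Ctx s ε) : 0 < s := by linarith [C.one_lt]

lemma pw (C : Ctx s ε) (n : ℕ) : 0 < s ^ n := pow_pos C.pos n

lemma one_le_pw (C : Ctx s ε) (n : ℕ) : 1 ≤ s ^ n := one_le_pow₀ C.one_lt.le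

lemma crit (C : Ctx s ε) : tent s (1 / 2) = s / 2 := by
  rw [tent_left C.pos le_rfl]; ring

lemma eps_le (C : Ctx s ε) : ε ≤ (s - 1) / 2 := by
  have := C.away 1 le_rfl
  rw [iterate_one, C.crit, abs_of_pos (by linarith [C.one_lt])] at this
  linarith

lemma exists_pow (C : Ctx s ε) (t : ℝ) : ∃ n : ℕ, t ≤ s ^ n / 2 := by
  obtain ⟨n, hn⟩ := pow_unbounded_of_one_lt (2 * t) C.one_lt
  exact ⟨n, by linarith⟩

end Ctx

open Classical in
/-- The `0`-th coordinate of the point of the zero composant at distance `t` from `0̄`. -/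
def FF (s t : ℝ) : ℝ :=
  if h : ∃ n : ℕ, t ≤ s ^ n / 2 then (tent s)^[Nat.find h] (t / s ^ (Nat.find h)) else 0

namespace Ctx
variable {s ε : ℝ}

lemma FF_eq (C : Ctx s ε) {t : ℝ} {n : ℕ} (h : t ≤ s ^ n / 2) :
    FF s t = (tent s)^[n] (t / s ^ n) := by
  classical
  have hex : ∃ n : ℕ, t ≤ s ^ n / 2 := ⟨n, h⟩
  unfold FF
  rw [dif_pos hex]
  have hm : Nat.find hex ≤ n := Nat.find_min' hex h
  have hspec := Nat.find_spec hex
  generalize Nat.find hex = m at *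
  clear h
  induction n, hm using Nat.le_induction with
  | base => rfl
  | succ k hk ih =>
    rw [ih, iterate_succ_apply, tent_left C.pos]
    · congr 1
      have := C.pw k; have := C.pos
      field_simp
      ring
    · rw [div_le_iff₀ (C.pw _)]
      have : s ^ m ≤ s ^ (k + 1) := pow_le_pow_right₀ C.one_lt.le (by omega)
      linarith

lemma FF_small' (C : Ctx s ε) {t : ℝ} (h : t ≤ 1 / 2) : FF s t = t := by
  have := C.FF_eq (t := t) (n := 0) (by simpa using h)
  simpa using this

lemma FF_mul (C : Ctx s ε) {t : ℝ} (ht : 0 ≤ t) : FF s (s * t) = tent s (FF s t) := by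
  obtain ⟨n, hn⟩ := C.exists_pow t
  have h2 : s * t ≤ s ^ (n + 1) / 2 := by
    rw [pow_succ]; nlinarith [C.pos]
  rw [C.FF_eq hn, C.FF_eq h2, ← iterate_succ_apply' (tent s)]
  congr 1
  have := C.pw n; have := C.pos
  field_simp
  ring

lemma FF_small (C : Ctx s ε) {t : ℝ} (h0 : 0 ≤ t) (h : t ≤ s / 2) : FF s t = t := by
  have h1 : t = s * (t / s) := by have := C.pos; field_simp
  have h2 : t / s ≤ 1 / 2 := by rw [div_le_iff₀ C.pos]; linarith
  rw [h1, C.FF_mul (div_nonneg h0 C.pos.le), C.FF_small' h2, tent_left C.pos h2]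

lemma FF_lip (C : Ctx s ε) (t u : ℝ) : |FF s t - FF s u| ≤ |t - u| := by
  obtain ⟨n, hn⟩ := C.exists_pow (max t u)
  rw [C.FF_eq (le_trans (le_max_left _ _) hn), C.FF_eq (le_trans (le_max_right _ _) hn)]
  refine (tent_iter_lip C.pos n _ _).trans ?_
  rw [← sub_div, abs_div, abs_of_pos (C.pw n), mul_div_cancel₀ _ (C.pw n).ne']

lemma FF_cont (C : Ctx s ε) : Continuous (FF s) := by
  have : LipschitzWith 1 (FF s) := LipschitzWith.of_dist_le_mul (fun x y => by
    simpa [Real.dist_eq] using C.FF_lip x y)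
  exact this.continuous

/-- `min t c₂ ≤ FF t`. -/
lemma FF_lower (C : Ctx s ε) {t : ℝ} (h0 : 0 ≤ t) : min t (s * (1 - s / 2)) ≤ FF s t := by
  obtain ⟨n, hn⟩ := C.exists_pow t
  have hs := C.one_lt; have hs2 := C.lt_two; have hp := C.pos
  induction n generalizing t with
  | zero => rw [C.FF_small' (by simpa using hn)]; exact min_le_left _ _
  | succ n ih =>
    have h1 : t = s * (t / s) := by field_simp
    have h0' : 0 ≤ t / s := div_nonneg h0 hp.le
    have h2 := ih h0' (by rw [div_le_iff₀ hp]; rw [pow_succ] at hn; linarith)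
    have h3 : FF s t = tent s (FF s (t / s)) := by rw [← C.FF_mul h0', ← h1]
    have h4 : FF s (t / s) ≤ s / 2 := by
      rcases le_total (t / s) (1 / 2) with h | h
      · rw [C.FF_small' h]; linarith
      · have h5 : t / s = s * (t / s / s) := by field_simp
        rw [h5, C.FF_mul (div_nonneg h0' hp.le)]; exact tent_le hp _
    rw [h3]
    rcases le_total (FF s (t / s)) (1 / 2) with h | h
    · rw [tent_left hp h]
      have h6 : 0 ≤ s * (1 - s / 2) := by nlinarith
      rcases le_total (t / s) (s * (1 - s / 2)) with h7 | h7
      · rw [min_eq_left h7] at h2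
        refine (min_le_left _ _).trans ?_
        calc t = s * (t / s) := h1
          _ ≤ _ := by nlinarith
      · rw [min_eq_right h7] at h2
        refine (min_le_right _ _).trans ?_
        nlinarith
    · rw [tent_right hp h]
      refine (min_le_right _ _).trans ?_
      nlinarith

lemma FF_le (C : Ctx s ε) {t : ℝ} (h0 : 0 ≤ t) : FF s t ≤ s / 2 := by
  rcases le_total t (1 / 2) with h | h
  · rw [C.FF_small' h]; linarith [C.one_lt]
  · have h5 : t = s * (t / s) := by have := C.pos; field_simp
    rw [h5, C.FF_mul (div_nonneg h0 C.pos.le)]; exact tent_le C.pos _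

lemma FF_nonneg (C : Ctx s ε) {t : ℝ} (h0 : 0 ≤ t) : 0 ≤ FF s t := by
  refine le_trans (le_min h0 ?_) (C.FF_lower h0)
  nlinarith [C.one_lt, C.lt_two]

lemma FF_le_self (C : Ctx s ε) {t : ℝ} (h0 : 0 ≤ t) : FF s t ≤ t := by
  have := C.FF_lip t 0
  rw [C.FF_small' (t := 0) (by norm_num), sub_zero, sub_zero, abs_of_nonneg h0] at this
  exact (le_abs_self _).trans this

end Ctx

/-- `GG s k t` is the `k`-th coordinate of the point at distance `t` from `0̄`. -/
def GG (s : ℝ) (k : ℕ) (t : ℝ) : ℝ := FF s (t / s ^ k)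

namespace Ctx
variable {s ε : ℝ}

lemma dn (C : Ctx s ε) (k : ℕ) {t : ℝ} (h : 0 ≤ t) : 0 ≤ t / s ^ k := div_nonneg h (C.pw k).le

lemma GG_succ (C : Ctx s ε) (k : ℕ) {t : ℝ} (h : 0 ≤ t) : tent s (GG s (k + 1) t) = GG s k t := by
  unfold GG
  rw [← C.FF_mul (C.dn _ h)]
  congr 1
  have := C.pw k; have := C.pos
  field_simp
  ring

lemma GG_iter (C : Ctx s ε) (k n : ℕ) {t : ℝ} (h : 0 ≤ t) :
    (tent s)^[n] (GG s (k + n) t) = GG s k t := by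
  induction n with
  | zero => rfl
  | succ n ih => rw [iterate_succ_apply, ← add_assoc, C.GG_succ _ h, ih]

lemma GG_lip (C : Ctx s ε) (k : ℕ) (t u : ℝ) : |GG s k t - GG s k u| ≤ |t - u| / s ^ k := by
  unfold GG
  refine (C.FF_lip _ _).trans ?_
  rw [← sub_div, abs_div, abs_of_pos (C.pw k)]

lemma GG_cont (C : Ctx s ε) (k : ℕ) : Continuous (GG s k) := by
  unfold GG
  exact C.FF_cont.comp (continuous_id.div_const _)

lemma GG_small (C : Ctx s ε) (k : ℕ) {t : ℝ} (h : 0 ≤ t) (h2 : t ≤ s ^ (k + 1) / 2) :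
    GG s k t = t / s ^ k := by
  unfold GG
  refine C.FF_small (C.dn _ h) ?_
  rw [div_le_iff₀ (C.pw k)]; rw [pow_succ] at h2; linarith

lemma GG_zero (s t : ℝ) : GG s 0 t = FF s t := by simp [GG]

/-- Coordinates of a point at a turn of level `k + n`. -/
lemma turn_val (C : Ctx s ε) {k n : ℕ} {t : ℝ} (h : 0 ≤ t) (ht : GG s (k + n) t = 1 / 2) :
    GG s k t = (tent s)^[n] (1 / 2) := by
  rw [← C.GG_iter k n h, ht]

/-- If there is no turn of positive level in `[x,y]` then `FF` is affine there. -/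
lemma affine_aux (C : Ctx s ε) (n : ℕ) : ∀ x y : ℝ, 0 ≤ x → y ≤ s ^ n / 2 →
    (∀ k, 1 ≤ k → ∀ t ∈ Icc x y, GG s k t ≠ 1 / 2) →
    (∀ t ∈ Icc x y, ∀ u ∈ Icc x y, FF s t - FF s u = t - u) ∨
    (∀ t ∈ Icc x y, ∀ u ∈ Icc x y, FF s t - FF s u = -(t - u)) := by
  have hp := C.pos
  induction n with
  | zero =>
    intro x y _ hy _
    left
    intro t ht u hu
    rw [C.FF_small' (by simpa using ht.2.trans hy), C.FF_small' (by simpa using hu.2.trans hy)]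
  | succ n ih =>
    intro x y hx hy hk
    rcases lt_or_ge y x with hxy | hxy
    · left; intro t ht; exact absurd (ht.1.trans ht.2) (by linarith)
    have hmem : ∀ t ∈ Icc x y, t / s ∈ Icc (x / s) (y / s) := fun t ht =>
      ⟨div_le_div_of_nonneg_right ht.1 hp.le, div_le_div_of_nonneg_right ht.2 hp.le⟩
    have hF : ∀ t ∈ Icc x y, FF s t = tent s (FF s (t / s)) := by
      intro t ht
      rw [← C.FF_mul (div_nonneg (hx.trans ht.1) hp.le)]
      congr 1; field_simp
    have ih' := ih (x / s) (y / s) (div_nonneg hx hp.le)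
      (by rw [div_le_iff₀ hp]; rw [pow_succ] at hy; linarith) (by
        intro k hk1 t ht
        have h1 := hk (k + 1) (by omega) (s * t)
          ⟨by have := ht.1; rw [div_le_iff₀ hp] at this; linarith,
           by have := ht.2; rw [le_div_iff₀ hp] at this; linarith⟩
        have h2 : GG s (k + 1) (s * t) = GG s k t := by
          unfold GG; congr 1; have := C.pw k; field_simp; ring
        rwa [h2] at h1)
    have hne : ∀ t ∈ Icc x y, FF s (t / s) ≠ 1 / 2 := by
      intro t ht
      have := hk 1 le_rfl t ht
      simpa [GG] using this
    have hside : (∀ t ∈ Icc x y, FF s (t / s) ≤ 1 / 2) ∨ (∀ t ∈ Icc x y, 1 / 2 ≤ FF s (t / s)) := by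
      by_contra hcon
      push Not at hcon
      obtain ⟨⟨t, ht, h1⟩, ⟨u, hu, h2⟩⟩ := hcon
      have hc : ContinuousOn (fun t => FF s (t / s)) (Icc x y) :=
        (C.FF_cont.comp (continuous_id.div_const _)).continuousOn
      obtain ⟨m, hm, hm2⟩ := isPreconnected_Icc.intermediate_value hu ht hc ⟨h2.le, h1.le⟩
      exact hne m hm hm2
    have key : ∀ t u : ℝ, s * (t / s - u / s) = t - u := by intro t u; field_simp
    rcases hside with hside | hside <;> rcases ih' with h | h
    · left; intro t ht u hu
      rw [hF t ht, hF u hu, tent_left hp (hside t ht), tent_left hp (hside u hu), ← mul_sub,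
        h _ (hmem t ht) _ (hmem u hu), key]
    · right; intro t ht u hu
      rw [hF t ht, hF u hu, tent_left hp (hside t ht), tent_left hp (hside u hu), ← mul_sub,
        h _ (hmem t ht) _ (hmem u hu), mul_neg, key]
    · right; intro t ht u hu
      rw [hF t ht, hF u hu, tent_right hp (hside t ht), tent_right hp (hside u hu)]
      have := h _ (hmem t ht) _ (hmem u hu)
      rw [← key t u, ← this]; ring
    · left; intro t ht u hu
      rw [hF t ht, hF u hu, tent_right hp (hside t ht), tent_right hp (hside u hu)]
      have := h _ (hmem t ht) _ (hmem u hu)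
      rw [← key t u, ← neg_neg (t / s - u / s), ← this]; ring

/-- If there is no turn of level `> i` in `[x,y]` then `GG s i` is affine there. -/
lemma affine (C : Ctx s ε) (i : ℕ) {x y : ℝ} (hx : 0 ≤ x)
    (hk : ∀ k, 1 ≤ k → ∀ t ∈ Icc x y, GG s (i + k) t ≠ 1 / 2) :
    (∀ t ∈ Icc x y, ∀ u ∈ Icc x y, GG s i t - GG s i u = (t - u) / s ^ i) ∨
    (∀ t ∈ Icc x y, ∀ u ∈ Icc x y, GG s i t - GG s i u = -(t - u) / s ^ i) := by
  have hp := C.pw i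
  obtain ⟨n, hn⟩ := C.exists_pow (y / s ^ i)
  have hmem : ∀ t ∈ Icc x y, t / s ^ i ∈ Icc (x / s ^ i) (y / s ^ i) := fun t ht =>
    ⟨div_le_div_of_nonneg_right ht.1 hp.le, div_le_div_of_nonneg_right ht.2 hp.le⟩
  rcases C.affine_aux n (x / s ^ i) (y / s ^ i) (C.dn _ hx) hn (by
      intro k hk1 t ht
      have h1 := hk k hk1 (s ^ i * t)
          ⟨by have := ht.1; rw [div_le_iff₀ hp] at this; linarith,
           by have := ht.2; rw [le_div_iff₀ hp] at this; linarith⟩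
      have h2 : GG s (i + k) (s ^ i * t) = GG s k t := by
        unfold GG; congr 1; have := C.pw k; rw [pow_add]; field_simp
      rwa [h2] at h1) with h | h
  · left; intro t ht u hu
    unfold GG
    rw [h _ (hmem t ht) _ (hmem u hu)]; ring
  · right; intro t ht u hu
    unfold GG
    rw [h _ (hmem t ht) _ (hmem u hu)]; ring

/-- In the zone around `1/2`, `GG s i` is affine. -/
lemma zone (C : Ctx s ε) (i : ℕ) {x y : ℝ} (hx : 0 ≤ x)
    (hz : ∀ t ∈ Icc x y, |GG s i t - 1 / 2| < ε) :
    (∀ t ∈ Icc x y, ∀ u ∈ Icc x y, GG s i t - GG s i u = (t - u) / s ^ i) ∨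
    (∀ t ∈ Icc x y, ∀ u ∈ Icc x y, GG s i t - GG s i u = -(t - u) / s ^ i) := by
  refine C.affine i hx ?_
  intro k hk t ht h
  have h1 := C.turn_val (hx.trans ht.1) h
  have h2 := C.away k hk
  rw [← h1] at h2
  linarith [hz t ht]

/-- The affine alternative written with absolute values. -/
lemma zone_abs (C : Ctx s ε) (i : ℕ) {x y : ℝ} (hx : 0 ≤ x)
    (hz : ∀ t ∈ Icc x y, |GG s i t - 1 / 2| < ε) :
    ∀ t ∈ Icc x y, ∀ u ∈ Icc x y, |GG s i t - GG s i u| = |t - u| / s ^ i := by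
  intro t ht u hu
  rcases C.zone i hx hz with h | h
  · rw [h t ht u hu, abs_div, abs_of_pos (C.pw i)]
  · rw [h t ht u hu, abs_div, abs_of_pos (C.pw i), abs_neg]

/-- Distinct turns are at distance at least `ε`. -/
lemma gap (C : Ctx s ε) {i j : ℕ} {v w : ℝ} (hv : 0 ≤ v) (hw : 0 ≤ w)
    (h1 : GG s i v = 1 / 2) (h2 : GG s j w = 1 / 2) (hd : |v - w| < ε) : v = w := by
  wlog hij : i ≤ j generalizing i j v w
  · exact (this hw hv h2 h1 (by rwa [abs_sub_comm]) (by omega)).symm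
  have hpi := C.one_le_pw i
  have hle : |v - w| / s ^ i < ε := lt_of_le_of_lt (div_le_self (abs_nonneg _) hpi) hd
  rcases eq_or_lt_of_le hij with rfl | hlt
  · wlog hvw : v ≤ w generalizing v w
    · exact (this hw hv h2 (by rwa [abs_sub_comm]) (by rwa [abs_sub_comm]) h1 (by linarith)).symm
    have := C.zone_abs i hv (y := w) (fun t ht => by
      rw [← h1]
      refine lt_of_le_of_lt (C.GG_lip i t v) (lt_of_le_of_lt ?_ hle)
      apply div_le_div_of_nonneg_right _ (C.pw i).le
      rw [abs_of_nonneg (by linarith [ht.1]), abs_of_nonpos (by linarith)]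
      linarith [ht.2]) v ⟨le_rfl, hvw⟩ w ⟨hvw, le_rfl⟩
    rw [h1, h2, sub_self, abs_zero] at this
    have h3 : |v - w| = 0 := by
      have h4 := C.pw i
      rcases div_eq_zero_iff.1 this.symm with h | h
      · exact h
      · exact absurd h h4.ne'
    linarith [abs_eq_zero.1 h3]
  · exfalso
    obtain ⟨n, rfl⟩ := Nat.exists_eq_add_of_lt hlt
    have h3 := C.turn_val (k := i) (n := n + 1) hw (by rw [← add_assoc]; exact h2)
    have h4 := C.away (n + 1) (by omega)
    rw [← h3, ← h1, abs_sub_comm] at h4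
    linarith [C.GG_lip i v w]

/-- Any interval of length more than `s ^ L` contains a turn of level `> L`. -/
lemma exists_turn (C : Ctx s ε) (L : ℕ) {x y : ℝ} (hx : 0 ≤ x) (hxy : x + s ^ L ≤ y) :
    ∃ k, L + 1 ≤ k ∧ ∃ t ∈ Icc x y, GG s k t = 1 / 2 := by
  by_contra hcon
  push Not at hcon
  have hp := C.pw L
  have hx' : x ∈ Icc x y := ⟨le_rfl, by linarith⟩
  have hy' : y ∈ Icc x y := ⟨by linarith, le_rfl⟩
  have h1 : 1 ≤ |GG s L y - GG s L x| := by
    have h2 : 1 ≤ (y - x) / s ^ L := by rw [le_div_iff₀ hp]; linarith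
    rcases C.affine L hx (y := y) (fun k hk t ht => hcon (L + k) (by omega) t ht) with h | h
    · rw [h y hy' x hx']; exact h2.trans (le_abs_self _)
    · rw [h y hy' x hx', neg_div, abs_neg]; exact h2.trans (le_abs_self _)
  have a1 := C.FF_nonneg (C.dn L hx)
  have a2 := C.FF_le (C.dn L hx)
  have hy0 : 0 ≤ y := by linarith
  have a3 := C.FF_nonneg (C.dn L hy0)
  have a4 := C.FF_le (C.dn L hy0)
  unfold GG at h1
  have := C.lt_two
  rw [le_abs] at h1
  rcases h1 with h1 | h1 <;> linarith

/-- `FF` does not stall. -/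
lemma nostall (C : Ctx s ε) {x η : ℝ} (hx : 0 ≤ x) (h0 : 0 < η) (hη : η < ε) :
    ∃ u ∈ Icc x (x + η), ∃ v ∈ Icc x (x + η), η / 3 ≤ |FF s u - FF s v| := by
  have hcase : (∀ k, 1 ≤ k → ∀ t ∈ Icc x (x + η / 3), GG s (0 + k) t ≠ 1 / 2) ∨
      (∀ k, 1 ≤ k → ∀ t ∈ Icc (x + 2 * η / 3) (x + η), GG s (0 + k) t ≠ 1 / 2) := by
    by_contra hcon
    push Not at hcon
    obtain ⟨⟨k, _, t, ht, h1⟩, ⟨l, _, u, hu, h2⟩⟩ := hcon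
    have a1 := ht.1; have a2 := ht.2; have a3 := hu.1; have a4 := hu.2
    have := C.gap (by linarith) (by linarith) h1 h2 (by
      rw [abs_of_nonpos (by linarith)]; linarith)
    linarith
  have fin : ∀ x' : ℝ, 0 ≤ x' → x ≤ x' → x' + η / 3 ≤ x + η →
      (∀ k, 1 ≤ k → ∀ t ∈ Icc x' (x' + η / 3), GG s (0 + k) t ≠ 1 / 2) →
      ∃ u ∈ Icc x (x + η), ∃ v ∈ Icc x (x + η), η / 3 ≤ |FF s u - FF s v| := by
    intro x' hx' hl hr h
    refine ⟨x' + η / 3, ⟨by linarith, hr⟩, x', ⟨hl, by linarith⟩, ?_⟩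
    rcases C.affine 0 hx' h with h | h <;>
    · have := h (x' + η / 3) ⟨by linarith, le_rfl⟩ x' ⟨le_rfl, by linarith⟩
      rw [GG_zero, GG_zero] at this
      rw [this, le_abs]
      simp
  rcases hcase with h | h
  · exact fin x hx le_rfl (by linarith) h
  · refine fin (x + 2 * η / 3) (by linarith) (by linarith) (by linarith) ?_
    have : x + 2 * η / 3 + η / 3 = x + η := by ring
    rwa [this]

end Ctx

/-! ### The fold lemma -/

lemma abs_alt {x y m : ℝ} (h : |(|x| - |y|)| ≤ m) : |x - y| ≤ m ∨ |x + y| ≤ m := by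
  rcases le_total 0 x with hx | hx <;> rcases le_total 0 y with hy | hy <;>
    simp only [abs_of_nonneg, abs_of_nonpos, hx, hy] at h
  · exact Or.inl h
  · right; rwa [sub_neg_eq_add] at h
  · right
    rw [show -x - y = -(x + y) by ring, abs_neg] at h; exact h
  · left
    rw [show -x - -y = -(x - y) by ring, abs_neg] at h; exact h

lemma cross_aux {P Q : ℝ → ℝ} {a b d : ℝ} (hP : ContinuousOn P (uIcc a b))
    (bQ : ∀ x ∈ uIcc a b, Q x ∈ uIcc (Q a) (Q b))
    (hd : ∀ x ∈ uIcc a b, |(|P x| - |Q x|)| ≤ d)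
    (ha : d < |Q a|) (hb : d < |Q b|)
    (sP : P a * P b < 0) (sQ : 0 < Q a * Q b) : False := by
  have h0 : (0 : ℝ) ∈ uIcc (P a) (P b) := by
    rw [mem_uIcc]
    rcases mul_neg_iff.1 sP with h | h
    · right; exact ⟨h.2.le, h.1.le⟩
    · left; exact ⟨h.1.le, h.2.le⟩
  obtain ⟨x, hx, hPx⟩ := intermediate_value_uIcc hP h0
  have h1 := hd x hx
  rw [hPx, abs_zero, zero_sub, abs_neg, abs_abs] at h1
  have h2 := bQ x hx
  rw [mem_uIcc] at h2
  rcases mul_pos_iff.1 sQ with h | h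
  · rw [abs_of_pos h.1] at ha
    rw [abs_of_pos h.2] at hb
    have := le_abs_self (Q x)
    rcases h2 with h2 | h2 <;> linarith
  · rw [abs_of_neg h.1] at ha
    rw [abs_of_neg h.2] at hb
    have := neg_le_abs (Q x)
    rcases h2 with h2 | h2 <;> linarith

lemma cross {P Q : ℝ → ℝ} {a b d : ℝ} (hP : ContinuousOn P (uIcc a b))
    (hQ : ContinuousOn Q (uIcc a b))
    (bP : ∀ x ∈ uIcc a b, P x ∈ uIcc (P a) (P b))
    (bQ : ∀ x ∈ uIcc a b, Q x ∈ uIcc (Q a) (Q b))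
    (hd : ∀ x ∈ uIcc a b, |(|P x| - |Q x|)| ≤ d)
    (ha : d < |P a|) (ha' : d < |Q a|) (hb : d < |P b|) (hb' : d < |Q b|)
    (sa : 0 < P a * Q a) (sb : P b * Q b < 0) : False := by
  have hs : (P a * P b) * (Q a * Q b) < 0 := by
    have : (P a * P b) * (Q a * Q b) = (P a * Q a) * (P b * Q b) := by ring
    rw [this]; exact mul_neg_of_pos_of_neg sa sb
  rcases mul_neg_iff.1 hs with h | h
  · exact cross_aux hQ bP (fun x hx => by rw [abs_sub_comm]; exact hd x hx) ha hb h.2 h.1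
  · exact cross_aux hP bQ hd ha' hb' h.1 h.2

namespace Ctx
variable {s ε : ℝ}

/-- A monotone path through the zone has monotone `i`-th coordinate (betweenness form). -/
lemma zone_between (C : Ctx s ε) (i : ℕ) {α : ℝ → ℝ} {a b : ℝ} (hα : Continuous α)
    (nα : ∀ t, 0 ≤ α t) (mα : ∀ x ∈ uIcc a b, α x ∈ uIcc (α a) (α b))
    (hz : ∀ t ∈ uIcc a b, |GG s i (α t) - 1 / 2| < ε) :
    ∀ x ∈ uIcc a b, GG s i (α x) - 1 / 2 ∈ uIcc (GG s i (α a) - 1 / 2) (GG s i (α b) - 1 / 2) := by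
  intro x hx
  have hz' : ∀ t ∈ uIcc (α a) (α b), |GG s i t - 1 / 2| < ε := by
    intro t ht
    obtain ⟨τ, hτ, rfl⟩ := intermediate_value_uIcc hα.continuousOn ht
    exact hz τ hτ
  have hx' := mα x hx
  have h0 : 0 ≤ min (α a) (α b) := le_min (nα a) (nα b)
  have hp := C.pw i
  have hda : α a ∈ uIcc (α a) (α b) := left_mem_uIcc
  have hdb : α b ∈ uIcc (α a) (α b) := right_mem_uIcc
  have h2 := hx'
  rw [mem_uIcc] at h2
  rw [mem_uIcc]
  rcases C.zone i h0 (y := max (α a) (α b)) hz' with h | h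
  · have e1 := h _ hx' _ hda
    have e2 := h _ hdb _ hx'
    rcases h2 with h2 | h2
    · left
      have : 0 ≤ (α x - α a) / s ^ i := div_nonneg (by linarith) hp.le
      have : 0 ≤ (α b - α x) / s ^ i := div_nonneg (by linarith) hp.le
      constructor <;> linarith
    · right
      have : (α x - α a) / s ^ i ≤ 0 := div_nonpos_of_nonpos_of_nonneg (by linarith) hp.le
      have : (α b - α x) / s ^ i ≤ 0 := div_nonpos_of_nonpos_of_nonneg (by linarith) hp.le
      constructor <;> linarith
  · have e1 := h _ hx' _ hda
    have e2 := h _ hdb _ hx'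
    rw [neg_div] at e1 e2
    rcases h2 with h2 | h2
    · right
      have : 0 ≤ (α x - α a) / s ^ i := div_nonneg (by linarith) hp.le
      have : 0 ≤ (α b - α x) / s ^ i := div_nonneg (by linarith) hp.le
      constructor <;> linarith
    · left
      have : (α x - α a) / s ^ i ≤ 0 := div_nonpos_of_nonpos_of_nonneg (by linarith) hp.le
      have : (α b - α x) / s ^ i ≤ 0 := div_nonpos_of_nonpos_of_nonneg (by linarith) hp.le
      constructor <;> linarith

/-- The crossing argument at the fold level. -/
lemma fold_cross (C : Ctx s ε) {α β : ℝ → ℝ} {R D : ℝ} {i : ℕ}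
    (hα : Continuous α) (hβ : Continuous β) (mα : Monotone α) (mβ : Antitone β)
    (nα : ∀ t, 0 ≤ α t) (nβ : ∀ t, 0 ≤ β t) (hD : 0 < D) (hDe : 1000 * D < ε)
    (hM : ∀ τ ∈ Icc 0 R,
      |(|GG s i (α τ) - 1 / 2| - |GG s i (β τ) - 1 / 2|)| ≤ D ∨
      (|(|GG s i (α τ) - 1 / 2| - |GG s i (β τ) - 1 / 2|)| ≤ 21 * D ∧
        200 * D < |GG s i (α τ) - 1 / 2|))
    (hO : ∃ τ ∈ Icc 0 R, |(GG s i (α τ) - 1 / 2) + (GG s i (β τ) - 1 / 2)| ≤ 21 * D ∧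
      19 * D ≤ |(GG s i (α τ) - 1 / 2) - (GG s i (β τ) - 1 / 2)|) :
    ∀ τ ∈ Icc 0 R, |(GG s i (α τ) - 1 / 2) + (GG s i (β τ) - 1 / 2)| ≤ 201 * D := by
  by_contra hcon
  push Not at hcon
  obtain ⟨τ₀, hτ₀, hbad⟩ := hcon
  obtain ⟨τ₁, hτ₁, hO1, hO2⟩ := hO
  set X : ℝ → ℝ := fun τ => GG s i (α τ) - 1 / 2 with hX
  set Y : ℝ → ℝ := fun τ => GG s i (β τ) - 1 / 2 with hY
  have cX : Continuous X := ((C.GG_cont i).comp hα).sub continuous_const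
  have cY : Continuous Y := ((C.GG_cont i).comp hβ).sub continuous_const
  have hM' : ∀ τ ∈ Icc 0 R, |(|X τ| - |Y τ|)| ≤ D ∨
      (|(|X τ| - |Y τ|)| ≤ 21 * D ∧ 200 * D < |X τ|) := hM
  have hM21 : ∀ τ ∈ Icc 0 R, |X τ - Y τ| ≤ 21 * D ∨ |X τ + Y τ| ≤ 21 * D := by
    intro τ hτ
    apply abs_alt
    rcases hM' τ hτ with h | h
    · linarith
    · exact h.1
  let CS : Set ℝ := Icc 0 R ∩ {τ | |X τ - Y τ| ≤ 21 * D ∧ 200 * D ≤ |X τ + Y τ|}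
  let CO : Set ℝ := Icc 0 R ∩ {τ | |X τ + Y τ| ≤ 21 * D ∧ 19 * D ≤ |X τ - Y τ|}
  have kS : IsCompact CS := isCompact_Icc.inter_right
    ((isClosed_le (cX.sub cY).abs continuous_const).inter
      (isClosed_le continuous_const (cX.add cY).abs))
  have kO : IsCompact CO := isCompact_Icc.inter_right
    ((isClosed_le (cX.add cY).abs continuous_const).inter
      (isClosed_le continuous_const (cX.sub cY).abs))
  have nS : CS.Nonempty := by
    refine ⟨τ₀, hτ₀, ?_, ?_⟩
    · rcases hM21 τ₀ hτ₀ with h | h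
      · exact h
      · exfalso; change 201 * D < |X τ₀ + Y τ₀| at hbad; linarith
    · change 201 * D < |X τ₀ + Y τ₀| at hbad; linarith
  have nO : CO.Nonempty := ⟨τ₁, hτ₁, hO1, hO2⟩
  obtain ⟨⟨a, b⟩, ⟨haS, hbO⟩, hmin⟩ := (kS.prod kO).exists_isMinOn (nS.prod nO)
    (f := fun p : ℝ × ℝ => |p.1 - p.2|) (by fun_prop)
  simp only at haS hbO
  have hmin' : ∀ x ∈ CS, ∀ y ∈ CO, |a - b| ≤ |x - y| := fun x hx y hy =>
    hmin (show (x, y) ∈ CS ×ˢ CO from ⟨hx, hy⟩)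
  have hsub : uIcc a b ⊆ Icc 0 R := (ordConnected_Icc).uIcc_subset haS.1 hbO.1
  -- strictly between, we are near
  have habs : ∀ x y : ℝ, 2 * |x| ≤ |x + y| + |x - y| := by
    intro x y
    have : 2 * |x| = |(x + y) + (x - y)| := by
      rw [show (x + y) + (x - y) = 2 * x by ring, abs_mul]; norm_num
    rw [this]; exact abs_add_le _ _
  have hin : ∀ x ∈ uIcc a b, x ≠ a → x ≠ b → |X x| ≤ 111 * D := by
    intro x hx hxa hxb
    have hxR := hsub hx
    have hlt1 : |x - b| < |a - b| := by
      rw [mem_uIcc] at hx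
      rcases hx with hx | hx
      · have h3 : a < x := lt_of_le_of_ne hx.1 (Ne.symm hxa)
        rw [abs_of_nonpos (by linarith), abs_of_nonpos (by linarith)]; linarith
      · have h3 : x < a := lt_of_le_of_ne hx.2 hxa
        rw [abs_of_nonneg (by linarith), abs_of_nonneg (by linarith)]; linarith
    have hlt2 : |a - x| < |a - b| := by
      rw [mem_uIcc] at hx
      rcases hx with hx | hx
      · have h3 : x < b := lt_of_le_of_ne hx.2 hxb
        rw [abs_of_nonpos (by linarith), abs_of_nonpos (by linarith)]; linarith
      · have h3 : b < x := lt_of_le_of_ne hx.1 (Ne.symm hxb)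
        rw [abs_of_nonneg (by linarith), abs_of_nonneg (by linarith)]; linarith
    have n1 : x ∉ CS := fun h => by linarith [hmin' x h b hbO]
    have n2 : x ∉ CO := fun h => by linarith [hmin' a haS x h]
    have := habs (X x) (Y x)
    rcases hM21 x hxR with h | h
    · have : |X x + Y x| < 200 * D := by
        by_contra h'
        exact n1 ⟨hxR, h, not_lt.1 h'⟩
      linarith
    · have : |X x - Y x| < 19 * D := by
        by_contra h'
        exact n2 ⟨hxR, h, not_lt.1 h'⟩
      linarith
  have hab : a ≠ b := by
    rintro rfl
    have h1 := haS.2; have h2 := hbO.2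
    linarith [h1.2, h2.1]
  have hnear : ∀ x ∈ uIcc a b, |X x| ≤ 111 * D := by
    have hcl : IsClosed {x | |X x| ≤ 111 * D} := isClosed_le cX.abs continuous_const
    have hioo : Ioo (min a b) (max a b) ⊆ {x | |X x| ≤ 111 * D} := by
      intro x hx
      have hx2 : x ∈ uIcc a b := ⟨hx.1.le, hx.2.le⟩
      refine hin x hx2 ?_ ?_
      · rintro rfl
        rcases le_total x b with h | h
        · have := hx.1; rw [min_eq_left h] at this; exact lt_irrefl _ this
        · have := hx.2; rw [max_eq_left h] at this; exact lt_irrefl _ this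
      · rintro rfl
        rcases le_total a x with h | h
        · have := hx.2; rw [max_eq_right h] at this; exact lt_irrefl _ this
        · have := hx.1; rw [min_eq_right h] at this; exact lt_irrefl _ this
    have := hcl.closure_subset_iff.2 hioo
    rw [closure_Ioo (by
      intro h; apply hab
      exact inf_eq_sup.1 h)] at this
    exact this
  have hd1 : ∀ x ∈ uIcc a b, |(|X x| - |Y x|)| ≤ D := by
    intro x hx
    rcases hM' x (hsub hx) with h | h
    · exact h
    · exfalso; linarith [hnear x hx, h.2]
  have hnearY : ∀ x ∈ uIcc a b, |Y x| ≤ 112 * D := by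
    intro x hx
    have h1 := abs_le.1 (hd1 x hx)
    linarith [hnear x hx, h1.1]
  have zX := C.zone_between i hα nα (a := a) (b := b) (fun x hx => by
      rw [mem_uIcc] at hx ⊢
      rcases hx with hx | hx
      · left; exact ⟨mα hx.1, mα hx.2⟩
      · right; exact ⟨mα hx.1, mα hx.2⟩) (fun x hx => by
      have := hnear x hx; change |X x| < ε; linarith)
  have zY := C.zone_between i hβ nβ (a := a) (b := b) (fun x hx => by
      rw [mem_uIcc] at hx ⊢
      rcases hx with hx | hx
      · right; exact ⟨mβ hx.2, mβ hx.1⟩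
      · left; exact ⟨mβ hx.2, mβ hx.1⟩) (fun x hx => by
      have := hnearY x hx; change |Y x| < ε; linarith)
  have haa : a ∈ uIcc a b := left_mem_uIcc
  have hbb : b ∈ uIcc a b := right_mem_uIcc
  -- at `a`
  have a1 : |X a - Y a| ≤ D := by
    rcases abs_alt (hd1 a haa) with h | h
    · exact h
    · exfalso; linarith [haS.2.2]
  have a2 : |X b + Y b| ≤ D := by
    rcases abs_alt (hd1 b hbb) with h | h
    · exfalso; linarith [hbO.2.2]
    · exact h
  have a3 := haS.2.2
  have a4 := hbO.2.2
  have sgnA : (99 * D ≤ X a ∧ 99 * D ≤ Y a) ∨ (X a ≤ -(99 * D) ∧ Y a ≤ -(99 * D)) := by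
    rw [abs_le] at a1
    rw [le_abs] at a3
    rcases a3 with h | h
    · left; constructor <;> linarith
    · right; constructor <;> linarith
  have sgnB : (9 * D ≤ X b ∧ Y b ≤ -(9 * D)) ∨ (X b ≤ -(9 * D) ∧ 9 * D ≤ Y b) := by
    rw [abs_le] at a2
    rw [le_abs] at a4
    rcases a4 with h | h
    · left; constructor <;> linarith
    · right; constructor <;> linarith
  refine cross cX.continuousOn cY.continuousOn zX zY hd1 ?_ ?_ ?_ ?_ ?_ ?_
  · rcases sgnA with h | h
    · exact lt_of_lt_of_le (by linarith) (le_abs_self (X a))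
    · exact lt_of_lt_of_le (by linarith) (neg_le_abs (X a))
  · rcases sgnA with h | h
    · exact lt_of_lt_of_le (by linarith) (le_abs_self (Y a))
    · exact lt_of_lt_of_le (by linarith) (neg_le_abs (Y a))
  · rcases sgnB with h | h
    · exact lt_of_lt_of_le (by linarith) (le_abs_self (X b))
    · exact lt_of_lt_of_le (by linarith) (neg_le_abs (X b))
  · rcases sgnB with h | h
    · exact lt_of_lt_of_le (by linarith) (neg_le_abs (Y b))
    · exact lt_of_lt_of_le (by linarith) (le_abs_self (Y b))
  · rcases sgnA with h | h
    · exact mul_pos (by linarith) (by linarith)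
    · exact mul_pos_of_neg_of_neg (by linarith) (by linarith)
  · rcases sgnB with h | h
    · exact mul_neg_of_pos_of_neg (by linarith) (by linarith)
    · exact mul_neg_of_neg_of_pos (by linarith) (by linarith)

/-- A point close to `1/2` at level `l` is not close to `1/2` at a higher level. -/
lemma not_near (C : Ctx s ε) {d x : ℝ} {l k : ℕ} (hx : 0 ≤ x) (hd : 0 < d) (hde : 1000 * d < ε)
    (hl : |GG s l x - 1 / 2| ≤ 400 * (d / s ^ l)) (hlk : l < k) :
    400 * (d / s ^ k) < |GG s k x - 1 / 2| := by
  by_contra hcon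
  push Not at hcon
  obtain ⟨n, rfl⟩ := Nat.exists_eq_add_of_lt hlk
  have h1 := C.GG_iter l (n + 1) hx
  have h2 := tent_iter_lip C.pos (n + 1) (GG s (l + (n + 1)) x) (1 / 2)
  rw [h1] at h2
  have h3 := C.away (n + 1) (by omega)
  have h4 : s ^ (n + 1) * |GG s (l + (n + 1)) x - 1 / 2| ≤ 400 * (d / s ^ l) := by
    calc s ^ (n + 1) * |GG s (l + (n + 1)) x - 1 / 2|
        ≤ s ^ (n + 1) * (400 * (d / s ^ (l + n + 1))) :=
          mul_le_mul_of_nonneg_left hcon (C.pw _).le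
      _ = 400 * (d / s ^ l) := by
          have := C.pw l; have := C.pos
          rw [add_assoc, pow_add s l]; field_simp
  have h5 : d / s ^ l ≤ d := div_le_self hd.le (C.one_le_pw l)
  have h6 := abs_sub_le ((tent s)^[n + 1] (1 / 2)) (GG s l x) (1 / 2)
  rw [abs_sub_comm ((tent s)^[n + 1] (1 / 2)) (GG s l x)] at h6
  linarith

/-- The fold lemma. -/
lemma fold (C : Ctx s ε) {α β : ℝ → ℝ} {R d : ℝ} (N : ℕ)
    (hα : Continuous α) (hβ : Continuous β) (mα : Monotone α) (mβ : Antitone β)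
    (nα : ∀ t, 0 ≤ α t) (nβ : ∀ t, 0 ≤ β t) (hd : 0 < d) (hde : 1000 * d < ε)
    (hN : ∀ τ ∈ Icc 0 R, |GG s N (α τ) - GG s N (β τ)| ≤ d / s ^ N)
    (hbig : ∃ τ ∈ Icc 0 R, 21 * d < |α τ - β τ|) :
    ∃ i, N < i ∧ ∀ τ ∈ Icc 0 R, |GG s i (α τ) + GG s i (β τ) - 1| ≤ 201 * (d / s ^ i) := by
  have hp := C.pos
  let E : ℕ → ℝ → Prop := fun k τ => |GG s k (α τ) - GG s k (β τ)| ≤ d / s ^ k ∨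
    (|GG s k (α τ) - GG s k (β τ)| ≤ 21 * (d / s ^ k) ∧
      ∃ l, N < l ∧ l ≤ k ∧ |GG s l (α τ) - 1 / 2| ≤ 10 * (d / s ^ l))
  have hE : ∃ k, N ≤ k ∧ (∀ τ ∈ Icc 0 R, E k τ) ∧ ¬ (∀ τ ∈ Icc 0 R, E (k + 1) τ) := by
    by_contra hcon
    push Not at hcon
    have hall : ∀ k, N ≤ k → ∀ τ ∈ Icc 0 R, E k τ := by
      intro k hk
      induction k, hk using Nat.le_induction with
      | base => intro τ hτ; exact Or.inl (hN τ hτ)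
      | succ k hk ih => exact hcon k hk ih
    obtain ⟨τ, hτ, hb⟩ := hbig
    obtain ⟨n, hn⟩ := C.exists_pow (max (α τ) (β τ))
    have hk := hall (N + n) (by omega) τ hτ
    have hpw : s ^ n ≤ s ^ (N + n + 1) := pow_le_pow_right₀ C.one_lt.le (by omega)
    have e1 := C.GG_small (N + n) (nα τ) (by linarith [le_max_left (α τ) (β τ)])
    have e2 := C.GG_small (N + n) (nβ τ) (by linarith [le_max_right (α τ) (β τ)])
    have h3 : |GG s (N + n) (α τ) - GG s (N + n) (β τ)| ≤ 21 * (d / s ^ (N + n)) := by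
      rcases hk with h | h
      · have : 0 < d / s ^ (N + n) := div_pos hd (C.pw _)
        linarith
      · exact h.1
    rw [e1, e2, ← sub_div, abs_div, abs_of_pos (C.pw _), ← mul_div_assoc,
      div_le_div_iff_of_pos_right (C.pw _)] at h3
    linarith
  obtain ⟨k, hk, hEk, hnE⟩ := hE
  push Not at hnE
  obtain ⟨τ₁, hτ₁, hnE⟩ := hnE
  have hD : 0 < d / s ^ (k + 1) := div_pos hd (C.pw _)
  have hDd : d / s ^ (k + 1) ≤ d := div_le_self hd.le (C.one_le_pw _)
  have hsD : d / s ^ k = s * (d / s ^ (k + 1)) := by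
    have := C.pw k
    rw [pow_succ]; field_simp
  have hM : ∀ τ ∈ Icc 0 R,
      |(|GG s (k + 1) (α τ) - 1 / 2| - |GG s (k + 1) (β τ) - 1 / 2|)| ≤ d / s ^ (k + 1) ∨
      (|(|GG s (k + 1) (α τ) - 1 / 2| - |GG s (k + 1) (β τ) - 1 / 2|)| ≤ 21 * (d / s ^ (k + 1)) ∧
        200 * (d / s ^ (k + 1)) < |GG s (k + 1) (α τ) - 1 / 2|) := by
    intro τ hτ
    have h1 := tent_diff hp (GG s (k + 1) (α τ)) (GG s (k + 1) (β τ))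
    rw [C.GG_succ k (nα τ), C.GG_succ k (nβ τ)] at h1
    rcases hEk τ hτ with h | ⟨h, l, hl1, hl2, hl3⟩
    · left
      rw [h1, hsD] at h
      exact le_of_mul_le_mul_left h hp
    · right
      constructor
      · rw [h1, hsD] at h
        refine le_of_mul_le_mul_left (a := s) ?_ hp
        linarith
      · have hl4 : 0 < d / s ^ l := div_pos hd (C.pw _)
        have := C.not_near (nα τ) hd hde (hl3.trans (by linarith)) (show l < k + 1 by omega)
        linarith
  refine ⟨k + 1, by omega, ?_⟩
  intro τ hτ
  have := C.fold_cross hα hβ mα mβ nα nβ hD (by linarith) hM (by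
    refine ⟨τ₁, hτ₁, ?_⟩
    set x := GG s (k + 1) (α τ₁) - 1 / 2 with hx
    set y := GG s (k + 1) (β τ₁) - 1 / 2 with hy
    have hxy : GG s (k + 1) (α τ₁) - GG s (k + 1) (β τ₁) = x - y := by rw [hx, hy]; ring
    have hnE' : ¬ (|x - y| ≤ d / s ^ (k + 1) ∨ (|x - y| ≤ 21 * (d / s ^ (k + 1)) ∧
      ∃ l, N < l ∧ l ≤ k + 1 ∧ |GG s l (α τ₁) - 1 / 2| ≤ 10 * (d / s ^ l))) := by
      rw [← hxy]; exact hnE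
    push Not at hnE'
    obtain ⟨n1, n2⟩ := hnE'
    have habs : 2 * |x| ≤ |x + y| + |x - y| := by
      have : 2 * |x| = |(x + y) + (x - y)| := by
        rw [show (x + y) + (x - y) = 2 * x by ring, abs_mul]; norm_num
      rw [this]; exact abs_add_le _ _
    have habs2 : |x - y| ≤ 2 * |x| + |x + y| := by
      have : 2 * |x| = |2 * x| := by rw [abs_mul]; norm_num
      rw [this, show x - y = 2 * x - (x + y) by ring]
      exact abs_sub _ _
    rcases hM τ₁ hτ₁ with h | ⟨h, h'⟩
    · rcases abs_alt h with h2 | h2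
      · linarith
      · refine ⟨by linarith, ?_⟩
        have : 10 * (d / s ^ (k + 1)) < |x| := by
          by_contra hc
          push Not at hc
          have := n2 (by linarith) (k + 1) (by omega) le_rfl
          linarith
        linarith
    · rcases abs_alt h with h2 | h2
      · have hcon : |x + y| ≤ 21 * (d / s ^ (k + 1)) ∨ True := Or.inr trivial
        exfalso
        rcases hEk τ₁ hτ₁ with h3 | ⟨h3, l, hl1, hl2, hl3⟩
        · have h1 := tent_diff hp (GG s (k + 1) (α τ₁)) (GG s (k + 1) (β τ₁))
          rw [C.GG_succ k (nα τ₁), C.GG_succ k (nβ τ₁)] at h1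
          rw [h1, hsD] at h3
          rcases abs_alt (le_of_mul_le_mul_left h3 hp) with h4 | h4
          · exact absurd n1 (not_lt.2 h4)
          · change |x + y| ≤ _ at h4
            linarith
        · have := n2 h2 l hl1 (by omega)
          linarith
      · exact ⟨h2, by linarith⟩) τ hτ
  convert this using 2
  ring

end Ctx

/-! ### The core argument about the induced map on the zero composant -/

/-- The properties of the induced map `g` on `[0,∞)` used in the core argument. -/
structure Half (s : ℝ) (g g' : ℝ → ℝ) : Prop where
  cont : Continuous g
  mono : Monotone g
  nonneg : ∀ t, 0 ≤ g t
  zero : g 0 = 0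
  linv : ∀ t, 0 ≤ t → g' (g t) = t
  close : ∀ N : ℕ, ∀ η : ℝ, 0 < η → ∃ J : ℕ, ∀ t u : ℝ, 0 ≤ t → 0 ≤ u →
    GG s J t = GG s J u → |GG s N (g t) - GG s N (g u)| ≤ η
  unif : ∀ η : ℝ, 0 < η → ∃ δ : ℝ, 0 < δ ∧ ∀ t u : ℝ, 0 ≤ t → 0 ≤ u → |t - u| ≤ δ →
    |g t - g u| ≤ η

lemma Half.coarse {s : ℝ} {g g' : ℝ → ℝ} (H : Half s g g') :
    ∃ A : ℝ, 0 < A ∧ ∀ t u : ℝ, 0 ≤ t → 0 ≤ u → |g t - g u| ≤ A * |t - u| + 1 := by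
  obtain ⟨δ, hδ, h⟩ := H.unif 1 one_pos
  have key : ∀ n : ℕ, ∀ t u : ℝ, 0 ≤ t → t ≤ u → u - t ≤ n * δ → |g t - g u| ≤ n := by
    intro n
    induction n with
    | zero =>
      intro t u ht htu hn
      have : t = u := by simp at hn; linarith
      simp [this]
    | succ n ih =>
      intro t u ht htu hn
      push_cast at hn ⊢
      have hw1 : t ≤ max t (u - δ) := le_max_left _ _
      have hw2 : max t (u - δ) ≤ u := max_le htu (by linarith)
      have hw3 : u - δ ≤ max t (u - δ) := le_max_right _ _
      have hw4 : max t (u - δ) - t ≤ n * δ := by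
        rcases max_cases t (u - δ) with h | h
        · rw [h.1, sub_self]; positivity
        · rw [h.1]; linarith
      have h1 := ih t (max t (u - δ)) ht hw1 hw4
      have h2 := h (max t (u - δ)) u (ht.trans hw1) (by linarith)
        (by rw [abs_le]; constructor <;> linarith)
      have := abs_sub_le (g t) (g (max t (u - δ))) (g u)
      linarith
  have key2 : ∀ t u : ℝ, 0 ≤ t → t ≤ u → |g t - g u| ≤ δ⁻¹ * |t - u| + 1 := by
    intro t u ht htu
    have h1 := Nat.le_ceil ((u - t) / δ)
    have h2 := Nat.ceil_lt_add_one (a := (u - t) / δ) (div_nonneg (by linarith) hδ.le)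
    have h3 := key _ t u ht htu ((div_le_iff₀ hδ).1 h1)
    rw [abs_sub_comm t u, abs_of_nonneg (by linarith : 0 ≤ u - t), inv_mul_eq_div]
    linarith
  refine ⟨δ⁻¹, inv_pos.2 hδ, fun t u ht hu => ?_⟩
  rcases le_total t u with htu | htu
  · exact key2 t u ht htu
  · rw [abs_sub_comm, abs_sub_comm t]; exact key2 u t hu htu

namespace Ctx
variable {s ε : ℝ}

lemma eps_half (C : Ctx s ε) : ε < 1 / 2 := by linarith [C.eps_le, C.lt_two]

lemma GG_le (C : Ctx s ε) (k : ℕ) {t : ℝ} (h : 0 ≤ t) : GG s k t ≤ t / s ^ k :=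
  C.FF_le_self (C.dn k h)

lemma turn_ge (C : Ctx s ε) {k : ℕ} {t : ℝ} (h : 0 ≤ t) (ht : GG s k t = 1 / 2) :
    s ^ k / 2 ≤ t := by
  have := C.GG_le k h
  rw [ht, le_div_iff₀ (C.pw k)] at this
  linarith

/-- Equality of coordinates is inherited by lower coordinates. -/
lemma GG_eq_of_le (C : Ctx s ε) {j k : ℕ} (hjk : j ≤ k) {t u : ℝ} (ht : 0 ≤ t) (hu : 0 ≤ u)
    (h : GG s k t = GG s k u) : GG s j t = GG s j u := by
  obtain ⟨n, rfl⟩ := Nat.exists_eq_add_of_le hjk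
  rw [← C.GG_iter j n ht, h, C.GG_iter j n hu]

lemma GG_eq_of_sum (C : Ctx s ε) {j k : ℕ} (hjk : j < k) {t u : ℝ} (ht : 0 ≤ t) (hu : 0 ≤ u)
    (h : GG s k t + GG s k u = 1) : GG s j t = GG s j u := by
  obtain ⟨n, rfl⟩ := Nat.exists_eq_add_of_lt hjk
  refine C.GG_eq_of_le (k := j + n) (by omega) ht hu ?_
  rw [← C.GG_succ _ ht, ← C.GG_succ _ hu, ← tent_sym]
  congr 1; linarith

lemma near_turn (C : Ctx s ε) {i : ℕ} {x η : ℝ} (hx : 0 ≤ x) (h0 : 0 ≤ η) (hη : 2 * η < ε)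
    (h : |GG s i x - 1 / 2| ≤ η / s ^ i) : ∃ v, 0 ≤ v ∧ GG s i v = 1 / 2 ∧ |v - x| ≤ η := by
  have hp := C.pw i
  have h1p := C.one_le_pw i
  have hxη : 0 ≤ x - η := by
    have h1 := C.GG_le i hx
    have h2 := (abs_le.1 h).1
    have h3 : 1 / 2 - η / s ^ i ≤ x / s ^ i := by linarith
    have h4 : 1 / 2 * s ^ i ≤ x + η := by
      rw [← le_div_iff₀ hp, add_div]; linarith
    linarith [C.eps_half]
  have hz : ∀ t ∈ Icc (x - η) (x + η), |GG s i t - 1 / 2| < ε := by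
    intro t ht
    have h1 := C.GG_lip i t x
    have h2 : |t - x| / s ^ i ≤ η / s ^ i := by
      gcongr; rw [abs_le]; constructor <;> linarith [ht.1, ht.2]
    have h3 : η / s ^ i ≤ η := div_le_self h0 h1p
    have := abs_sub_le (GG s i t) (GG s i x) (1 / 2)
    linarith
  have hxm : x ∈ Icc (x - η) (x + η) := ⟨by linarith, by linarith⟩
  have hab := abs_le.1 h
  have hb1 : s ^ i * (1 / 2 - GG s i x) ≤ η := by
    have := mul_le_mul_of_nonneg_left hab.1 hp.le
    have h5 : s ^ i * (-(η / s ^ i)) = -η := by field_simp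
    nlinarith
  have hb2 : -η ≤ s ^ i * (1 / 2 - GG s i x) := by
    have := mul_le_mul_of_nonneg_left hab.2 hp.le
    have h5 : s ^ i * (η / s ^ i) = η := by field_simp
    nlinarith
  rcases C.zone i hxη hz with hh | hh
  · have hv : x + s ^ i * (1 / 2 - GG s i x) ∈ Icc (x - η) (x + η) := ⟨by linarith, by linarith⟩
    refine ⟨_, hxη.trans hv.1, ?_, ?_⟩
    · have := hh _ hv _ hxm
      rw [add_sub_cancel_left, mul_div_cancel_left₀ _ hp.ne'] at this
      linarith
    · rw [add_sub_cancel_left, abs_le]; exact ⟨hb2, hb1⟩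
  · have hv : x - s ^ i * (1 / 2 - GG s i x) ∈ Icc (x - η) (x + η) := ⟨by linarith, by linarith⟩
    refine ⟨_, hxη.trans hv.1, ?_, ?_⟩
    · have := hh _ hv _ hxm
      rw [sub_sub_cancel_left, neg_neg, mul_div_cancel_left₀ _ hp.ne'] at this
      linarith
    · rw [sub_sub_cancel_left, abs_neg, abs_le]; exact ⟨hb2, hb1⟩

variable {g g' : ℝ → ℝ}

lemma reflect (C : Ctx s ε) (H : Half s g g') (H' : Half s g' g) {d : ℝ} (hd : 0 < d)
    (hde : 1000 * d < ε) (N : ℕ) :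
    ∃ J : ℕ, ∀ l, J ≤ l → ∀ u R : ℝ, s ^ l * (ε / 2) ≤ R → R ≤ u →
      (∀ τ ∈ Icc 0 R, GG s l (u + τ) + GG s l (u - τ) = 1) →
      ∃ i, N < i ∧ ∀ τ ∈ Icc 0 R,
        |GG s i (g (u + τ)) + GG s i (g (u - τ)) - 1| ≤ 201 * (d / s ^ i) := by
  obtain ⟨J, hJ⟩ := H.close N (d / s ^ N) (div_pos hd (C.pw N))
  obtain ⟨A, hA, hco⟩ := H'.coarse
  obtain ⟨n, hn⟩ := C.exists_pow ((A * (21 * d) + 2) / ε)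
  refine ⟨max (J + 1) n, fun l hl u R hR hRu hsym => ?_⟩
  have hlJ : J < l := lt_of_lt_of_le (Nat.lt_succ_self J) ((le_max_left _ _).trans hl)
  have hln : n ≤ l := (le_max_right _ _).trans hl
  have hR0 : 0 ≤ R := le_trans (by have := C.pw l; have := C.eps_pos; positivity) hR
  refine C.fold (α := fun τ => g (u + τ)) (β := fun τ => g (u - τ)) (R := R) N
    (H.cont.comp (by fun_prop)) (H.cont.comp (by fun_prop))
    (fun a b hab => H.mono (by linarith)) (fun a b hab => H.mono (by linarith))
    (fun _ => H.nonneg _) (fun _ => H.nonneg _) hd hde ?_ ?_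
  · intro τ hτ
    have h1 : 0 ≤ u + τ := by linarith [hτ.1]
    have h2 : 0 ≤ u - τ := by linarith [hτ.2]
    exact hJ _ _ h1 h2 (C.GG_eq_of_sum hlJ h1 h2 (hsym τ hτ))
  · refine ⟨R, ⟨hR0, le_rfl⟩, ?_⟩
    by_contra hcon
    push Not at hcon
    have h1 := hco (g (u + R)) (g (u - R)) (H.nonneg _) (H.nonneg _)
    rw [H.linv _ (by linarith), H.linv _ (by linarith)] at h1
    have h2 : |u + R - (u - R)| = 2 * R := by
      rw [abs_of_nonneg (by linarith)]; ring
    rw [h2] at h1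
    have h3 : A * |g (u + R) - g (u - R)| ≤ A * (21 * d) := by gcongr
    have h4 : s ^ n ≤ s ^ l := pow_le_pow_right₀ C.one_lt.le hln
    rw [div_le_iff₀ C.eps_pos] at hn
    have h5 : s ^ n * ε ≤ s ^ l * ε := mul_le_mul_of_nonneg_right h4 C.eps_pos.le
    have := C.pw n
    have := C.eps_pos
    nlinarith

lemma turn_sym (C : Ctx s ε) {l : ℕ} {u : ℝ} (hu : 0 ≤ u) (h : GG s l u = 1 / 2) :
    s ^ l * (ε / 2) ≤ u ∧ ∀ τ ∈ Icc 0 (s ^ l * (ε / 2)), GG s l (u + τ) + GG s l (u - τ) = 1 := by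
  have hp := C.pw l
  have he := C.eps_pos
  have h1 : s ^ l * (ε / 2) ≤ u := by
    have := C.turn_ge hu h
    have := C.eps_half
    nlinarith
  refine ⟨h1, fun τ hτ => ?_⟩
  have hz : ∀ t ∈ Icc (u - τ) (u + τ), |GG s l t - 1 / 2| < ε := by
    intro t ht
    have h1 := C.GG_lip l t u
    rw [h] at h1
    have h2 : |t - u| / s ^ l ≤ ε / 2 := by
      rw [div_le_iff₀ hp, abs_le]; constructor <;> linarith [ht.1, ht.2, hτ.2]
    linarith
  have hτ0 := hτ.1
  have hm : u ∈ Icc (u - τ) (u + τ) := ⟨by linarith, by linarith⟩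
  have hm1 : u - τ ∈ Icc (u - τ) (u + τ) := ⟨by linarith, by linarith⟩
  have hm2 : u + τ ∈ Icc (u - τ) (u + τ) := ⟨by linarith, by linarith⟩
  rcases C.zone l (by linarith [hτ.2]) hz with hh | hh
  · have e1 := hh _ hm1 _ hm
    have e2 := hh _ hm2 _ hm
    rw [sub_sub_cancel_left, neg_div, h] at e1
    rw [add_sub_cancel_left, h] at e2
    linarith
  · have e1 := hh _ hm1 _ hm
    have e2 := hh _ hm2 _ hm
    rw [sub_sub_cancel_left, neg_neg, h] at e1
    rw [add_sub_cancel_left, neg_div, h] at e2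
    linarith

lemma half_of_sum {x e : ℝ} (h : |x + x - 1| ≤ 201 * e) : |x - 1 / 2| ≤ 101 * e := by
  have h0 : 0 ≤ e := by
    have := abs_nonneg (x + x - 1); linarith
  rw [abs_le] at *; constructor <;> linarith [h.1, h.2]

lemma zone_q (C : Ctx s ε) (j : ℕ) :
    s ^ j * (ε / 2) ≤ (s - 1) * s ^ j / 2 ∧ (s - 1) * s ^ j / 2 ≤ s ^ j / 2 ∧
    ∀ τ ∈ Icc 0 ((s - 1) * s ^ j / 2), GG s j (s ^ j / 2 + τ) + GG s j (s ^ j / 2 - τ) = 1 := by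
  have hp := C.pw j
  have he := C.eps_le
  have he0 := C.eps_pos
  have h2 := C.lt_two
  refine ⟨by nlinarith, by nlinarith, fun τ hτ => ?_⟩
  have h3 : (s - 1) * s ^ j / 2 ≤ s ^ j / 2 := by nlinarith
  rw [C.GG_small j (by linarith [hτ.1]) (by rw [pow_succ]; linarith [hτ.2]),
    C.GG_small j (by linarith [hτ.2]) (by rw [pow_succ]; nlinarith [hτ.1, C.one_lt])]
  field_simp
  ring

lemma not_turn (C : Ctx s ε) (j m : ℕ) {w : ℝ}
    (h1 : GG s m w = 1 / 2) (h2 : |w - (1 - s / 2) * s ^ j| < ε) : False := by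
  have hp := C.pw j
  have hs := C.one_lt
  have hs2 := C.lt_two
  have he := C.eps_le
  have hx : 0 ≤ (1 - s / 2) * s ^ j := by
    apply mul_nonneg _ hp.le; linarith
  have hl := C.GG_lip m w ((1 - s / 2) * s ^ j)
  rw [h1] at hl
  have h3 : |w - (1 - s / 2) * s ^ j| / s ^ m < ε :=
    lt_of_le_of_lt (div_le_self (abs_nonneg _) (C.one_le_pw m)) h2
  have hj : GG s j ((1 - s / 2) * s ^ j) = 1 - s / 2 := by
    rw [C.GG_small j hx (by rw [pow_succ]; nlinarith)]
    field_simp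
  suffices hh : ε ≤ |1 / 2 - GG s m ((1 - s / 2) * s ^ j)| by linarith
  rcases lt_trichotomy m j with hmj | hmj | hmj
  · obtain ⟨n, rfl⟩ := Nat.exists_eq_add_of_lt hmj
    have e1 := C.GG_iter m (n + 1) hx
    rw [← add_assoc, hj, iterate_succ_apply, tent_sym, ← C.crit, ← iterate_succ_apply,
      ← iterate_succ_apply, C.crit] at e1
    rw [← e1, abs_sub_comm]
    exact C.away _ (by omega)
  · subst hmj
    rw [hj, abs_of_nonneg (by linarith)]; linarith
  · have h4 := C.GG_le m hx
    have h5 : (1 - s / 2) * s ^ j / s ^ m ≤ 1 - s / 2 := by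
      rw [div_le_iff₀ (C.pw m)]
      apply mul_le_mul_of_nonneg_left _ (by linarith)
      exact pow_le_pow_right₀ hs.le hmj.le
    rw [abs_of_nonneg (by linarith)]; linarith

lemma refl_down (C : Ctx s ε) {i i' : ℕ} (hi : i' ≤ i) {p y e : ℝ} (hp : 0 ≤ p) (hy : 0 ≤ y)
    (h : |GG s i p + GG s i y - 1| ≤ e / s ^ i) :
    |GG s i' y - 1 / 2| ≤ |GG s i' p - 1 / 2| + e / s ^ i' := by
  rcases eq_or_lt_of_le hi with rfl | hlt
  · have e1 : GG s i' y - 1 / 2 = (GG s i' p + GG s i' y - 1) - (GG s i' p - 1 / 2) := by ring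
    rw [e1]
    have := abs_sub (GG s i' p + GG s i' y - 1) (GG s i' p - 1 / 2)
    linarith
  · obtain ⟨n, rfl⟩ := Nat.exists_eq_add_of_lt hlt
    have e1 := C.GG_iter i' (n + 1) hp
    have e2 := C.GG_iter i' (n + 1) hy
    rw [← add_assoc] at e1 e2
    rw [iterate_succ_apply, ← tent_sym, ← iterate_succ_apply] at e2
    have h1 := tent_iter_lip C.pos (n + 1) (1 - GG s (i' + n + 1) y) (GG s (i' + n + 1) p)
    rw [e1, e2] at h1
    have h2 : |1 - GG s (i' + n + 1) y - GG s (i' + n + 1) p| ≤ e / s ^ (i' + n + 1) := by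
      rw [← abs_neg]; convert h using 2; ring
    have h3 : s ^ (n + 1) * (e / s ^ (i' + n + 1)) = e / s ^ i' := by
      have := C.pw i'; have := C.pw (n + 1)
      rw [add_assoc i' n 1, pow_add s i' (n + 1), div_mul_eq_div_div, mul_div_cancel₀ _ (C.pw (n + 1)).ne']
    have h4 : s ^ (n + 1) * |1 - GG s (i' + n + 1) y - GG s (i' + n + 1) p| ≤ e / s ^ i' := by
      rw [← h3]; exact mul_le_mul_of_nonneg_left h2 (C.pw _).le
    have := abs_sub_le (GG s i' y) (GG s i' p) (1 / 2)
    linarith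

end Ctx

lemma eventually_step (I : ℕ → ℕ) (J c : ℕ) (h1 : ∀ j, J ≤ j → I j < I (j + 1))
    (h2 : ∀ j, J ≤ j → I j ≤ j + c) : ∃ J', J ≤ J' ∧ ∀ j, J' ≤ j → I (j + 1) = I j + 1 := by
  by_contra hcon
  push Not at hcon
  have hstep : ∀ j, J ≤ j → ∀ k, I j + k ≤ I (j + k) := by
    intro j hj k
    induction k with
    | zero => simp
    | succ k ih => have := h1 (j + k) (by omega); rw [← add_assoc j]; omega
  have key : ∀ n, ∃ j, J ≤ j ∧ j + n ≤ I j + J := by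
    intro n
    induction n with
    | zero =>
      refine ⟨J, le_rfl, by omega⟩
    | succ n ih =>
      obtain ⟨j, hj, hn⟩ := ih
      obtain ⟨k, hk, hk2⟩ := hcon j hj
      have h3 := h1 k (by omega)
      have h4 := hstep j hj (k - j)
      rw [show j + (k - j) = k by omega] at h4
      exact ⟨k + 1, by omega, by omega⟩
  obtain ⟨j, hj, hn⟩ := key (c + J + 1)
  have := h2 j hj
  omega

namespace Ctx
variable {s ε : ℝ} {g g' : ℝ → ℝ}

lemma turn_map (C : Ctx s ε) (H : Half s g g') (H' : Half s g' g) {d : ℝ} (hd : 0 < d)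
    (hde : 1000 * d < ε) (N : ℕ) :
    ∃ J : ℕ, ∀ l, J ≤ l → ∀ u, 0 ≤ u → GG s l u = 1 / 2 →
      ∃ i, N < i ∧ ∃ v, 0 ≤ v ∧ GG s i v = 1 / 2 ∧ |v - g u| ≤ 101 * d := by
  obtain ⟨J, hJ⟩ := C.reflect H H' hd hde N
  refine ⟨J, fun l hl u hu ht => ?_⟩
  obtain ⟨h1, h2⟩ := C.turn_sym hu ht
  obtain ⟨i, hi, h3⟩ := hJ l hl u _ le_rfl h1 h2
  refine ⟨i, hi, ?_⟩
  have h4 := h3 0 ⟨le_rfl, by have := C.pw l; have := C.eps_pos; positivity⟩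
  rw [add_zero, sub_zero] at h4
  have h5 := half_of_sum h4
  exact C.near_turn (η := 101 * d) (H.nonneg u) (by linarith) (by linarith)
    (by rw [mul_div_assoc]; exact h5)

/-- Values of `GG` near `1 - s/2` force the argument to be small. -/
lemma small_of_low (C : Ctx s ε) {i : ℕ} {y e : ℝ} (hy : 0 ≤ y) (he : 0 ≤ e)
    (he2 : 2 * e < (s - 1) * (2 - s)) (h : GG s i y ≤ 1 - s / 2 + e / s ^ i) :
    y ≤ (1 - s / 2) * s ^ i + e := by
  have hp := C.pw i
  have h1 := C.FF_lower (C.dn i hy)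
  have h2 : FF s (y / s ^ i) = GG s i y := rfl
  rw [h2] at h1
  have h3 : e / s ^ i ≤ e := div_le_self he (C.one_le_pw i)
  have h4 : GG s i y < s * (1 - s / 2) := by nlinarith
  rcases min_le_iff.1 h1 with h5 | h5
  · have h6 := h5.trans h
    rw [div_le_iff₀ hp, add_mul, div_mul_cancel₀ _ hp.ne'] at h6
    exact h6
  · linarith

/-- The reflection statement at the points `s^j/2`. -/
def Star (s d : ℝ) (g : ℝ → ℝ) (i j : ℕ) : Prop :=
  ∀ τ ∈ Icc 0 ((s - 1) * s ^ j / 2),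
    |GG s i (g (s ^ j / 2 + τ)) + GG s i (g (s ^ j / 2 - τ)) - 1| ≤ 201 * (d / s ^ i)

lemma Rnn (C : Ctx s ε) (j : ℕ) : 0 ≤ (s - 1) * s ^ j / 2 := by
  have := C.pw j; have := C.one_lt
  have : 0 ≤ s - 1 := by linarith
  positivity

lemma star_mid (C : Ctx s ε) {d : ℝ} {i j : ℕ} (h : Star s d g i j) :
    |GG s i (g (s ^ j / 2)) - 1 / 2| ≤ 101 * (d / s ^ i) := by
  have := h 0 ⟨le_rfl, C.Rnn j⟩
  rw [add_zero, sub_zero] at this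
  exact half_of_sum this

lemma star_end (C : Ctx s ε) {d : ℝ} {i j : ℕ} (h : Star s d g i j) :
    |GG s i (g (s ^ (j + 1) / 2)) + GG s i (g ((1 - s / 2) * s ^ j)) - 1| ≤ 201 * (d / s ^ i) := by
  have := h _ ⟨C.Rnn j, le_rfl⟩
  convert this using 6
  · rw [pow_succ]; ring
  · ring

lemma star_bound (C : Ctx s ε) (H : Half s g g') : ∃ c : ℕ, ∀ d i j, 0 < d → 1000 * d < ε →
    Star s d g i j → i ≤ j + c := by
  obtain ⟨A, hA, hco⟩ := H.coarse
  obtain ⟨c, hc⟩ := C.exists_pow (A + 4)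
  refine ⟨c, fun d i j hd hde h => ?_⟩
  have hp := C.pw i
  have hj := C.one_le_pw j
  have h1 := abs_le.1 (C.star_mid h)
  have h2 := C.GG_le i (H.nonneg (s ^ j / 2))
  have h3 : d / s ^ i ≤ d := div_le_self hd.le (C.one_le_pw i)
  have he := C.eps_half
  have h4 : 1 / 4 ≤ g (s ^ j / 2) / s ^ i := by linarith [h1.1]
  rw [le_div_iff₀ hp] at h4
  have h5 := hco (s ^ j / 2) 0 (by positivity) le_rfl
  rw [H.zero, sub_zero, sub_zero, abs_of_nonneg (H.nonneg _), abs_of_nonneg (by positivity)] at h5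
  have h6 : s ^ i ≤ s ^ (j + c) := by
    rw [pow_add]
    have h7 : s ^ j * (2 * (A + 4)) ≤ s ^ j * s ^ c := by
      apply mul_le_mul_of_nonneg_left _ (by linarith); linarith
    have := mul_nonneg hA.le (by linarith : 0 ≤ s ^ j)
    nlinarith
  exact (pow_le_pow_iff_right₀ C.one_lt).1 h6

lemma star_lt (C : Ctx s ε) {d : ℝ} {N : ℕ} (H : Half s g g') (hd : 0 < d) (hde : 1000 * d < ε)
    (hinv : ∀ l, N ≤ l → ∀ u, 0 ≤ u → GG s l u = 1 / 2 →
      ∃ i, 0 < i ∧ ∃ v, 0 ≤ v ∧ GG s i v = 1 / 2 ∧ |v - g' u| ≤ ε / 10)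
    (hun : ∀ t u : ℝ, 0 ≤ t → 0 ≤ u → |t - u| ≤ 302 * d → |g' t - g' u| ≤ ε / 100)
    {i i' j : ℕ} (hi : N < i') (h : Star s d g i j) (h' : Star s d g i' (j + 1)) : i < i' := by
  by_contra hcon
  push Not at hcon
  have h1 := C.star_mid h'
  have h2 := C.star_end h
  have e0 : (201 * (d / s ^ i)) = 201 * d / s ^ i := by ring
  rw [e0] at h2
  have h3 := C.refl_down hcon (H.nonneg _) (H.nonneg _) h2
  have h4 : |GG s i' (g ((1 - s / 2) * s ^ j)) - 1 / 2| ≤ 302 * d / s ^ i' := by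
    have : 302 * d / s ^ i' = 101 * (d / s ^ i') + 201 * d / s ^ i' := by ring
    linarith
  obtain ⟨w, hw, hw1, hw2⟩ := C.near_turn (H.nonneg _) (by linarith) (by linarith) h4
  obtain ⟨m, hm, v, hv, hv1, hv2⟩ := hinv i' hi.le w hw hw1
  have h5 := hun w _ hw (H.nonneg _) hw2
  rw [H.linv _ (mul_nonneg (by linarith [C.lt_two]) (C.pw j).le)] at h5
  have h6 := abs_sub_le v (g' w) ((1 - s / 2) * s ^ j)
  exact C.not_turn j m hv1 (by linarith [C.eps_pos])

lemma star_exact (C : Ctx s ε) {d : ℝ} (H : Half s g g') (hd : 0 < d) (hde : 1000 * d < ε)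
    (hd2 : 1000 * d < (s - 1) * (2 - s)) {i j : ℕ} (h : Star s d g i j)
    (h' : Star s d g (i + 1) (j + 1)) :
    g (s ^ j / 2) ≤ s ^ (i + 1) / 2 ∧ |g (s ^ j / 2) - s ^ i / 2| ≤ 101 * d := by
  have hp := C.pw i
  have hp1 := C.one_le_pw i
  have hs := C.one_lt
  have hs2 := C.lt_two
  have hel := C.eps_le
  have h1 := C.star_mid h'
  have h2 := abs_le.1 (C.star_end h)
  have hdi : 0 < d / s ^ i := div_pos hd hp
  have h3 : |GG s i (g (s ^ (j + 1) / 2)) - s / 2| ≤ 101 * (d / s ^ i) := by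
    rw [← C.GG_succ i (H.nonneg _), ← C.crit]
    refine (tent_lip C.pos _ _).trans ?_
    calc _ ≤ s * (101 * (d / s ^ (i + 1))) := mul_le_mul_of_nonneg_left h1 C.pos.le
      _ = 101 * (d / s ^ i) := by
        have := C.pos
        rw [pow_succ]; field_simp
  have h3' := abs_le.1 h3
  have key : ∀ y, 0 ≤ y → GG s i y ≤ 1 - s / 2 + 302 * (d / s ^ i) → y < s ^ (i + 1) / 2 := by
    intro y hy hh
    have h5 := C.small_of_low (e := 302 * d) hy (by linarith) (by nlinarith)
      (by rw [mul_div_assoc]; exact hh)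
    rw [pow_succ]
    nlinarith
  have h4 : g (s ^ j / 2 - (s - 1) * s ^ j / 2) < s ^ (i + 1) / 2 := by
    have : s ^ j / 2 - (s - 1) * s ^ j / 2 = (1 - s / 2) * s ^ j := by ring
    rw [this]
    exact key _ (H.nonneg _) (by linarith [h2.2, h3'.1])
  have h6 : g (s ^ j / 2) ≤ s ^ (i + 1) / 2 := by
    by_contra hcon
    push Not at hcon
    have hc : ContinuousOn (fun τ => g (s ^ j / 2 - τ)) (Icc 0 ((s - 1) * s ^ j / 2)) :=
      (H.cont.comp (by fun_prop)).continuousOn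
    have := intermediate_value_Icc' (C.Rnn j) hc
    obtain ⟨τ, hτ, hτ2⟩ := this ⟨h4.le, by simpa using hcon.le⟩
    have h7 := h τ hτ
    simp only at hτ2
    rw [hτ2, C.GG_small i (by positivity : 0 ≤ s ^ (i + 1) / 2) le_rfl] at h7
    have e1 : s ^ (i + 1) / 2 / s ^ i = s / 2 := by rw [pow_succ]; field_simp
    rw [e1] at h7
    have h8 := key _ (H.nonneg (s ^ j / 2 + τ)) (by linarith [(abs_le.1 h7).2])
    have h9 := H.mono (by linarith [hτ.1] : s ^ j / 2 ≤ s ^ j / 2 + τ)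
    linarith
  refine ⟨h6, ?_⟩
  have h7 := C.star_mid h
  rw [C.GG_small i (H.nonneg _) h6] at h7
  have e1 : g (s ^ j / 2) / s ^ i - 1 / 2 = (g (s ^ j / 2) - s ^ i / 2) / s ^ i := by
    field_simp
  rw [e1, abs_div, abs_of_pos hp, ← mul_div_assoc] at h7
  exact (div_le_div_iff_of_pos_right hp).1 h7

lemma star_step (C : Ctx s ε) {d : ℝ} (H : Half s g g') (hd : 0 < d) {i j : ℕ}
    (h : Star s d g i j) (h1 : g (s ^ j / 2) ≤ s ^ (i + 1) / 2)
    (h2 : |g (s ^ (j + 1) / 2) - s ^ (i + 1) / 2| ≤ 101 * d)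
    {τ : ℝ} (hτ : τ ∈ Icc 0 ((s - 1) * s ^ j / 2)) :
    |g (s ^ j / 2 + τ) + g (s ^ j / 2 - τ) - s ^ i| ≤ 403 * d := by
  have hp := C.pw i
  have hq := C.pw (i + 1)
  have h3 := h τ hτ
  have h4 : g (s ^ j / 2 - τ) ≤ s ^ (i + 1) / 2 := (H.mono (by linarith [hτ.1])).trans h1
  rw [C.GG_small i (H.nonneg _) h4] at h3
  have h5 : g (s ^ j / 2 + τ) ≤ s ^ (i + 1) / 2 + 101 * d := by
    have h6 : s ^ j / 2 + τ ≤ s ^ (j + 1) / 2 := by rw [pow_succ]; linarith [hτ.2]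
    linarith [H.mono h6, (abs_le.1 h2).2]
  have h6 : |GG s i (g (s ^ j / 2 + τ)) - g (s ^ j / 2 + τ) / s ^ i| ≤ 202 * d / s ^ i := by
    set x := g (s ^ j / 2 + τ) with hx
    have hx0 : 0 ≤ x := H.nonneg _
    set m := min x (s ^ (i + 1) / 2) with hm
    have hm0 : 0 ≤ m := le_min hx0 (by positivity)
    have hm1 : m ≤ s ^ (i + 1) / 2 := min_le_right _ _
    have e1 := C.GG_small i hm0 hm1
    have e2 := C.GG_lip i x m
    have e3 : |x - m| ≤ 101 * d := by
      rcases min_cases x (s ^ (i + 1) / 2) with hh | hh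
      · rw [hm, hh.1, sub_self, abs_zero]; linarith
      · rw [hm, hh.1, abs_of_pos (by linarith)]; linarith
    have e4 : |x - m| / s ^ i ≤ 101 * d / s ^ i := by gcongr
    have e5 : |m / s ^ i - x / s ^ i| ≤ 101 * d / s ^ i := by
      rw [← sub_div, abs_div, abs_of_pos hp, abs_sub_comm]; exact e4
    have e6 := abs_sub_le (GG s i x) (GG s i m) (x / s ^ i)
    rw [e1] at e6 e2
    have e7 : 202 * d / s ^ i = 101 * d / s ^ i + 101 * d / s ^ i := by ring
    rw [e1]  at *
    linarith
  have h7 : |(g (s ^ j / 2 + τ) + g (s ^ j / 2 - τ) - s ^ i) / s ^ i| ≤ 403 * d / s ^ i := by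
    have e1 : (g (s ^ j / 2 + τ) + g (s ^ j / 2 - τ) - s ^ i) / s ^ i =
        (GG s i (g (s ^ j / 2 + τ)) + g (s ^ j / 2 - τ) / s ^ i - 1) -
        (GG s i (g (s ^ j / 2 + τ)) - g (s ^ j / 2 + τ) / s ^ i) := by field_simp; ring
    rw [e1]
    have := abs_sub (GG s i (g (s ^ j / 2 + τ)) + g (s ^ j / 2 - τ) / s ^ i - 1)
        (GG s i (g (s ^ j / 2 + τ)) - g (s ^ j / 2 + τ) / s ^ i)
    have e2 : 403 * d / s ^ i = 201 * (d / s ^ i) + 202 * d / s ^ i := by ring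
    linarith
  rw [abs_div, abs_of_pos hp] at h7
  exact (div_le_div_iff_of_pos_right hp).1 h7

theorem core (C : Ctx s ε) (H : Half s g g') (H' : Half s g' g) :
    ∃ i J : ℕ, ∃ M : ℝ, 0 < M ∧ ∀ t, 0 ≤ t → |g t - s ^ i / s ^ J * t| ≤ M := by
  have hs := C.one_lt
  have hs2 := C.lt_two
  have hε := C.eps_pos
  -- constants
  obtain ⟨δ, hδ, hun⟩ := H'.unif (ε / 100) (by linarith)
  obtain ⟨d, hd, hd1, hd2, hd3⟩ : ∃ d : ℝ, 0 < d ∧ 1000 * d < ε ∧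
      1000 * d < (s - 1) * (2 - s) ∧ 302 * d ≤ δ := by
    have h1 : 0 < (s - 1) * (2 - s) := mul_pos (by linarith) (by linarith)
    have h2 : 0 < min ε (min ((s - 1) * (2 - s)) δ) := lt_min hε (lt_min h1 hδ)
    refine ⟨min ε (min ((s - 1) * (2 - s)) δ) / 2000, by linarith, ?_, ?_, ?_⟩
    · have := min_le_left ε (min ((s - 1) * (2 - s)) δ); linarith
    · have := (min_le_right ε (min ((s - 1) * (2 - s)) δ)).trans (min_le_left _ _); linarith
    · have := (min_le_right ε (min ((s - 1) * (2 - s)) δ)).trans (min_le_right _ _); linarith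
  obtain ⟨N, hN⟩ := C.turn_map H' H (d := ε / 2000) (by linarith) (by linarith) 0
  have hinv : ∀ l, N ≤ l → ∀ u, 0 ≤ u → GG s l u = 1 / 2 →
      ∃ i, 0 < i ∧ ∃ v, 0 ≤ v ∧ GG s i v = 1 / 2 ∧ |v - g' u| ≤ ε / 10 := by
    intro l hl u hu ht
    obtain ⟨i, hi, v, hv, h1, h2⟩ := hN l hl u hu ht
    exact ⟨i, hi, v, hv, h1, by linarith⟩
  obtain ⟨J0, hJ0⟩ := C.reflect H H' hd hd1 N
  obtain ⟨J1, hJ1⟩ := C.turn_map H H' hd hd1 N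
  have hstar : ∀ j, ∃ i, J0 ≤ j → N < i ∧ Star s d g i j := by
    intro j
    by_cases hj : J0 ≤ j
    · obtain ⟨h1, h2, h3⟩ := C.zone_q j
      obtain ⟨i, hi, h4⟩ := hJ0 j hj _ _ h1 h2 h3
      exact ⟨i, fun _ => ⟨hi, h4⟩⟩
    · exact ⟨0, fun h => absurd h hj⟩
  choose I hI using hstar
  obtain ⟨c, hc⟩ := C.star_bound H
  have hlt : ∀ j, max J0 J1 ≤ j → I j < I (j + 1) := by
    intro j hj
    have hj := (le_max_left _ _).trans hj
    exact C.star_lt H hd hd1 hinv (fun t u ht hu h => hun t u ht hu (h.trans hd3))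
      (hI (j + 1) (by omega)).1 (hI j hj).2 (hI (j + 1) (by omega)).2
  obtain ⟨J, hJ, hstep⟩ := eventually_step I (max J0 J1) c hlt
    (fun j hj => hc d _ _ hd hd1 (hI j ((le_max_left _ _).trans hj)).2)
  have hJ0J : J0 ≤ J := (le_max_left _ _).trans hJ
  have hJ1J : J1 ≤ J := (le_max_right _ _).trans hJ
  have hIj : ∀ k, I (J + k) = I J + k := by
    intro k
    induction k with
    | zero => rfl
    | succ k ih => rw [← add_assoc, hstep _ (by omega), ih]; ring
  have hS : ∀ j, J ≤ j → Star s d g (I j) j := fun j hj => (hI j (by omega)).2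
  have hB : ∀ j, J ≤ j → g (s ^ j / 2) ≤ s ^ (I j + 1) / 2 ∧
      |g (s ^ j / 2) - s ^ (I j) / 2| ≤ 101 * d := by
    intro j hj
    refine C.star_exact H hd hd1 hd2 (hS j hj) ?_
    have := hS (j + 1) (by omega)
    rwa [hstep j hj] at this
  set lam := s ^ (I J) / s ^ J with hlam
  have hlam0 : 0 < lam := div_pos (C.pw _) (C.pw _)
  have hlj : ∀ j, J ≤ j → lam * s ^ j = s ^ (I j) := by
    intro j hj
    obtain ⟨k, rfl⟩ := Nat.exists_eq_add_of_le hj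
    have := C.pw J
    rw [hIj, hlam, pow_add, pow_add]; field_simp
  have claim : ∀ k, ∀ u, 0 ≤ u → u ≤ s ^ (J + k) / 2 → ∀ l, J ≤ l → GG s l u = 1 / 2 →
      |g u - lam * u| ≤ 101 * d := by
    -- turns at the points `s^l/2`
    have hq : ∀ l, J ≤ l → ∀ u, 0 ≤ u → u ≤ s ^ (l + 1) / 2 → GG s l u = 1 / 2 →
        |g u - lam * u| ≤ 101 * d := by
      intro l hl u hu h1 h2
      have hp := C.pw l
      rw [C.GG_small l hu h1, div_eq_iff hp.ne'] at h2
      have h3 : u = s ^ l / 2 := by linarith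
      have h4 : lam * u = s ^ (I l) / 2 := by rw [h3, ← hlj l hl]; ring
      rw [h4, h3]; exact (hB l hl).2
    intro k
    induction k with
    | zero =>
      intro u hu h1 l hl h2
      refine hq l hl u hu (h1.trans ?_) h2
      have : s ^ (J + 0) ≤ s ^ (l + 1) := pow_le_pow_right₀ hs.le (by omega)
      linarith
    | succ k ih =>
      intro u hu h1 l hl h2
      set j := J + k with hj
      rcases le_or_gt j l with hjl | hjl
      · refine hq l hl u hu (h1.trans ?_) h2
        have : s ^ (J + (k + 1)) ≤ s ^ (l + 1) := pow_le_pow_right₀ hs.le (by omega)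
        linarith
      rcases le_or_gt u (s ^ j / 2) with hu1 | hu1
      · exact ih u hu hu1 l hl h2
      have hτ : u - s ^ j / 2 ∈ Icc 0 ((s - 1) * s ^ j / 2) := by
        refine ⟨by linarith, ?_⟩
        rw [← add_assoc, ← hj, pow_succ] at h1
        linarith
      obtain ⟨z1, z2, z3⟩ := C.zone_q j
      have h3 := z3 _ hτ
      rw [add_sub_cancel] at h3
      have hu' : 0 ≤ s ^ j / 2 - (u - s ^ j / 2) := by linarith [hτ.2]
      have h4 : GG s l (s ^ j / 2 - (u - s ^ j / 2)) = 1 / 2 := by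
        rw [← C.GG_eq_of_sum hjl hu hu' h3, h2]
      have h5 := ih _ hu' (by linarith) l hl h4
      have hB1 := (hB (j + 1) (by omega)).2
      rw [hstep j (by omega)] at hB1
      have h6 := C.star_step H hd (hS j (by omega)) (hB j (by omega)).1 hB1 hτ
      rw [add_sub_cancel, ← hlj j (by omega)] at h6
      have h7 : |g u - lam * u| ≤ 504 * d := by
        rw [abs_le] at h5 h6 ⊢
        constructor <;> nlinarith [h5.1, h5.2, h6.1, h6.2]
      obtain ⟨i, _, v, hv, hv1, hv2⟩ := hJ1 l (by omega) u hu h2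
      have hlu : 0 ≤ lam * u := by positivity
      have h8 : GG s (I l) (lam * u) = 1 / 2 := by
        rw [← h2]; unfold GG; congr 1
        rw [← hlj l hl]
        have := C.pw l
        field_simp
      have h9 : v = lam * u := by
        refine C.gap hv hlu hv1 h8 ?_
        have := abs_sub_le v (g u) (lam * u)
        linarith
      rw [← h9, abs_sub_comm]; exact hv2
  have hturn : ∀ u, 0 ≤ u → ∀ l, J ≤ l → GG s l u = 1 / 2 → |g u - lam * u| ≤ 101 * d := by
    intro u hu l hl ht
    obtain ⟨n, hn⟩ := C.exists_pow u
    refine claim n u hu (hn.trans ?_) l hl ht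
    have : s ^ n ≤ s ^ (J + n) := pow_le_pow_right₀ hs.le (by omega)
    linarith
  have hpJ := C.pw J
  refine ⟨I J, J, lam * s ^ J + 101 * d, by positivity, fun t ht => ?_⟩
  rw [abs_le]
  constructor
  · rcases le_or_gt (s ^ J) t with h1 | h1
    · obtain ⟨k, hk, u, hu, hu1⟩ := C.exists_turn J (x := t - s ^ J) (y := t)
        (by linarith) (by linarith)
      have h2 := abs_le.1 (hturn u (by linarith [hu.1]) k (by omega) hu1)
      have h3 := H.mono hu.2
      have h4 := mul_le_mul_of_nonneg_left hu.1 hlam0.le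
      nlinarith [h2.1]
    · have := H.nonneg t
      nlinarith
  · obtain ⟨k, hk, u, hu, hu1⟩ := C.exists_turn J (x := t) (y := t + s ^ J) ht le_rfl
    have h2 := abs_le.1 (hturn u (by linarith [hu.1]) k (by omega) hu1)
    have h3 := H.mono hu.1
    have h4 := mul_le_mul_of_nonneg_left hu.2 hlam0.le
    nlinarith [h2.2]

end Ctx

/-! ### The inverse limit space -/

/-- Non-recurrence of the critical point gives a uniform lower bound. -/
lemma exists_ctx (s : ℝ) (hs1 : Real.sqrt 2 < s) (hs2 : s < 2)
    (hnr : (1 : ℝ) / 2 ∉ omegaSet (tent s) (1 / 2)) : ∃ ε, Ctx s ε := by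
  have h1s : 1 < s := by
    refine lt_of_le_of_lt ?_ hs1
    rw [show (1 : ℝ) = Real.sqrt 1 by simp]
    exact Real.sqrt_le_sqrt (by norm_num)
  have hper : ∀ n, 1 ≤ n → (tent s)^[n] (1 / 2) ≠ 1 / 2 := by
    intro n hn h
    apply hnr
    refine ⟨fun k => n * (k + 1), ?_, ?_⟩
    · intro a b hab
      exact Nat.mul_lt_mul_of_pos_left (by omega) (by omega)
    · have : ∀ k, (tent s)^[n * (k + 1)] (1 / 2) = 1 / 2 := by
        intro k
        rw [iterate_mul]
        exact iterate_fixed h (k + 1)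
      simp only [this]
      exact tendsto_const_nhds
  have hfar : ∃ ε > 0, ∃ N : ℕ, ∀ n, N ≤ n → ε ≤ |(tent s)^[n] (1 / 2) - 1 / 2| := by
    by_contra hcon
    push Not at hcon
    have hfreq : ∀ n : ℕ, ∃ᶠ k in atTop, |(tent s)^[k] (1 / 2) - 1 / 2| < 1 / ((n : ℝ) + 1) := by
      intro n
      rw [frequently_atTop]
      intro N
      obtain ⟨k, hk, hk2⟩ := hcon (1 / ((n : ℝ) + 1)) (by positivity) N
      exact ⟨k, hk, hk2⟩
    obtain ⟨φ, hφ, hφ2⟩ := extraction_forall_of_frequently hfreq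
    refine hnr ⟨φ, hφ, ?_⟩
    rw [tendsto_iff_dist_tendsto_zero]
    refine squeeze_zero (fun _ => dist_nonneg) (fun n => (hφ2 n).le)
      tendsto_one_div_add_atTop_nhds_zero_nat
  obtain ⟨ε, hε, N, hN⟩ := hfar
  have hfin : ∀ N : ℕ, ∃ ε > 0, ∀ n, 1 ≤ n → n < N → ε ≤ |(tent s)^[n] (1 / 2) - 1 / 2| := by
    intro N
    induction N with
    | zero => exact ⟨1, one_pos, fun n _ h => absurd h (by omega)⟩
    | succ N ih =>
      obtain ⟨e, he, h⟩ := ih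
      rcases Nat.eq_zero_or_pos N with rfl | hpos
      · exact ⟨1, one_pos, fun n _ h => absurd h (by omega)⟩
      · refine ⟨min e |(tent s)^[N] (1 / 2) - 1 / 2|,
          lt_min he (abs_pos.2 (sub_ne_zero.2 (hper N hpos))), fun n h1 h2 => ?_⟩
        rcases Nat.lt_succ_iff_lt_or_eq.1 h2 with h3 | rfl
        · exact (min_le_left _ _).trans (h n h1 h3)
        · exact min_le_right _ _
  obtain ⟨e, he, h⟩ := hfin N
  refine ⟨min e ε, h1s, hs2, lt_min he hε, fun n hn => ?_⟩
  rcases lt_or_ge n N with h3 | h3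
  · exact (min_le_left _ _).trans (h n hn h3)
  · exact (min_le_right _ _).trans (hN n h3)

lemma invLim_iter {s : ℝ} (x : invLim s) (k n : ℕ) : (tent s)^[n] (x.1 (k + n)) = x.1 k := by
  induction n with
  | zero => rfl
  | succ n ih => rw [iterate_succ_apply, ← add_assoc, ← x.2.2, ih]

lemma invLim_eq_of_ge {s : ℝ} {x y : invLim s} (m : ℕ) (h : ∀ n, x.1 (m + n) = y.1 (m + n)) :
    x = y := by
  apply Subtype.ext
  funext k
  rw [← invLim_iter x k m, ← invLim_iter y k m, add_comm k m, h]

instance compact_invLim (s : ℝ) : CompactSpace (invLim s) := by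
  rw [← isCompact_iff_compactSpace]
  have hK : IsCompact (Set.pi univ (fun _ : ℕ => Icc (0 : ℝ) 1)) :=
    isCompact_univ_pi (fun _ => isCompact_Icc)
  refine hK.of_isClosed_subset ?_ ?_
  · have : invLim s = (⋂ n, {x : ℕ → ℝ | x n ∈ Icc (0 : ℝ) 1}) ∩
        ⋂ n, {x : ℕ → ℝ | x n = tent s (x (n + 1))} := by
      ext x; simp [invLim]
    rw [this]
    refine IsClosed.inter (isClosed_iInter fun n => ?_) (isClosed_iInter fun n => ?_)
    · exact isClosed_Icc.preimage (continuous_apply n)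
    · exact isClosed_eq (continuous_apply n) ((tent_cont s).comp (continuous_apply (n + 1)))
  · intro x hx n _
    exact hx.1 n

lemma coord_cont (s : ℝ) (k : ℕ) : Continuous (fun x : invLim s => x.1 k) :=
  (continuous_apply k).comp continuous_subtype_val

/-- Uniform continuity on the inverse limit. -/
lemma unif_K {s : ℝ} {F : invLim s → ℝ} (hF : Continuous F) {η : ℝ} (hη : 0 < η) :
    ∃ n : ℕ, ∀ x y : invLim s, (∀ k ≤ n, |x.1 k - y.1 k| ≤ 1 / ((n : ℝ) + 1)) → |F x - F y| < η := by
  by_contra hcon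
  push Not at hcon
  let S : ℕ → Set (invLim s × invLim s) := fun n =>
    {p | (∀ k ≤ n, |p.1.1 k - p.2.1 k| ≤ 1 / ((n : ℝ) + 1)) ∧ η ≤ |F p.1 - F p.2|}
  have hcl : ∀ n, IsClosed (S n) := by
    intro n
    refine IsClosed.and ?_ ?_
    · simp only [Set.ofPred_forall]
      refine isClosed_iInter fun k => isClosed_iInter fun _ => ?_
      exact isClosed_le (((coord_cont s k).comp continuous_fst).sub
        ((coord_cont s k).comp continuous_snd)).abs continuous_const
    · exact isClosed_le continuous_const
        ((hF.comp continuous_fst).sub (hF.comp continuous_snd)).abs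
  have hne := IsCompact.nonempty_iInter_of_sequence_nonempty_isCompact_isClosed S
    (fun n p hp => ⟨fun k hk => (hp.1 k (by omega)).trans (by
      apply one_div_le_one_div_of_le (by positivity); push_cast; linarith), hp.2⟩)
    (fun n => by
      obtain ⟨x, y, h1, h2⟩ := hcon n
      exact ⟨(x, y), h1, h2⟩)
    (hcl 0).isCompact hcl
  obtain ⟨⟨x, y⟩, hp⟩ := hne
  rw [mem_iInter] at hp
  have hxy : x = y := by
    apply Subtype.ext
    funext k
    have h1 : ∀ n : ℕ, |x.1 k - y.1 k| ≤ 1 / ((n : ℝ) + 1) := by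
      intro n
      refine ((hp (max n k)).1 k (le_max_right _ _)).trans ?_
      apply one_div_le_one_div_of_le (by positivity)
      have : (n : ℝ) ≤ (max n k : ℕ) := by exact_mod_cast le_max_left n k
      linarith
    have h2 : |x.1 k - y.1 k| ≤ 0 :=
      ge_of_tendsto' tendsto_one_div_add_atTop_nhds_zero_nat h1
    have := abs_nonpos_iff.1 h2
    linarith
  have h3 := (hp 0).2
  simp only [hxy, sub_self, abs_zero] at h3
  linarith

namespace Ctx
variable {s ε : ℝ}

lemma coord_le (C : Ctx s ε) (x : invLim s) (k : ℕ) : x.1 k ≤ s / 2 := by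
  rw [x.2.2 k]; exact tent_le C.pos _

/-- The parametrization of the composant of `0̄`. -/
def phi (C : Ctx s ε) (t : ℝ) : invLim s :=
  ⟨fun k => GG s k (max t 0), fun k => ⟨C.FF_nonneg (C.dn k (le_max_right _ _)),
    (C.FF_le (C.dn k (le_max_right _ _))).trans (by linarith [C.lt_two])⟩,
    fun k => (C.GG_succ k (le_max_right _ _)).symm⟩

lemma phi_apply (C : Ctx s ε) {t : ℝ} (ht : 0 ≤ t) (k : ℕ) : (C.phi t).1 k = GG s k t := by
  show GG s k (max t 0) = _
  rw [max_eq_left ht]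

lemma phi_max (C : Ctx s ε) (t : ℝ) : C.phi (max t 0) = C.phi t := by
  apply Subtype.ext
  funext k
  show GG s k (max (max t 0) 0) = GG s k (max t 0)
  simp

lemma phi_lip (C : Ctx s ε) (k : ℕ) (t u : ℝ) :
    |(C.phi t).1 k - (C.phi u).1 k| ≤ 1 * |t - u| := by
  show |GG s k (max t 0) - GG s k (max u 0)| ≤ _
  refine (C.GG_lip k _ _).trans ((div_le_self (abs_nonneg _) (C.one_le_pw k)).trans ?_)
  rw [one_mul]
  exact abs_max_sub_max_le_abs t u 0

lemma phi_inj (C : Ctx s ε) {t u : ℝ} (ht : 0 ≤ t) (hu : 0 ≤ u) (h : C.phi t = C.phi u) :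
    t = u := by
  obtain ⟨n, hn⟩ := C.exists_pow (max t u)
  have h1 : s ^ n ≤ s ^ (n + 1) := pow_le_pow_right₀ C.one_lt.le (by omega)
  have h2 : GG s n t = GG s n u := by
    rw [← C.phi_apply ht, ← C.phi_apply hu, h]
  have := le_max_left t u
  have := le_max_right t u
  rw [C.GG_small n ht (by linarith), C.GG_small n hu (by linarith)] at h2
  exact (div_left_inj' (C.pw n).ne').1 h2

lemma phi_dense (C : Ctx s ε) (z : invLim s) (n : ℕ) :
    ∃ t, 0 ≤ t ∧ ∀ k ≤ n, (C.phi t).1 k = z.1 k := by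
  have hp := C.pw n
  have h0 : 0 ≤ s ^ n * z.1 n := mul_nonneg hp.le (z.2.1 n).1
  refine ⟨s ^ n * z.1 n, h0, fun k hk => ?_⟩
  obtain ⟨j, rfl⟩ := Nat.exists_eq_add_of_le hk
  rw [← invLim_iter z k j, ← invLim_iter (C.phi _) k j]
  congr 1
  rw [C.phi_apply h0, C.GG_small _ h0 (by
    rw [pow_succ]; have := C.coord_le z (k + j); nlinarith)]
  field_simp

/-- A point whose coordinates shrink at the right rate lies on the zero composant. -/
lemma phi_of_bdd (C : Ctx s ε) (z : invLim s) (B : ℝ) (n0 : ℕ) (hn0 : B ≤ s ^ n0 / 2)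
    (h : ∀ n, n0 ≤ n → s ^ n * z.1 n ≤ B) : z = C.phi (s ^ n0 * z.1 n0) := by
  have h0 : 0 ≤ s ^ n0 * z.1 n0 := mul_nonneg (C.pw _).le (z.2.1 n0).1
  have hmono : ∀ n, n0 ≤ n → s ^ n0 ≤ s ^ n := fun n hn => pow_le_pow_right₀ C.one_lt.le hn
  have hc : ∀ n, s ^ (n0 + n) * z.1 (n0 + n) = s ^ n0 * z.1 n0 := by
    intro n
    induction n with
    | zero => rfl
    | succ n ih =>
      rw [← ih, z.2.2 (n0 + n), tent_left C.pos]
      · rw [← add_assoc, pow_succ]; ring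
      · have h1 := h (n0 + n + 1) (by omega)
        have h2 := hmono (n0 + n + 1) (by omega)
        have h3 := C.pw (n0 + n + 1)
        by_contra hcon
        push Not at hcon
        nlinarith
  apply invLim_eq_of_ge n0
  intro n
  have hp := C.pw (n0 + n)
  rw [C.phi_apply h0, C.GG_small _ h0, ← hc n]
  · field_simp
  · have h1 := h n0 le_rfl
    have h2 := hmono (n0 + n + 1) (by omega)
    linarith

/-- One step of path lifting. -/
lemma lift_step (C : Ctx s ε) {γ : ℝ → invLim s} (hc : Continuous γ) {η δ : ℝ}
    (h0 : 0 < η) (hη : η < ε)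
    (hu : ∀ t t', |t - t'| ≤ δ → |(γ t).1 0 - (γ t').1 0| < η / 7) {t t' a : ℝ} (ha : 0 ≤ a)
    (hγ : γ t = C.phi a) (htt : |t - t'| ≤ δ) :
    ∃ a', 0 ≤ a' ∧ γ t' = C.phi a' ∧ |a - a'| ≤ η := by
  obtain ⟨n0, hn0⟩ := C.exists_pow (a + η)
  have hmono : ∀ n, n0 ≤ n → s ^ n0 ≤ s ^ n := fun n hn => pow_le_pow_right₀ C.one_lt.le hn
  have key : ∀ n, n0 ≤ n → ∀ x, 0 ≤ x → x + η ≤ a + η →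
      (Icc (x / s ^ n) ((x + η) / s ^ n) ⊆ (fun r => (γ r).1 n) '' (uIcc t t')) → False := by
    intro n hn x hx hxa hsub
    obtain ⟨u, hu1, v, hv1, huv⟩ := C.nostall hx h0 hη
    have hp := C.pw n
    have aux : ∀ u ∈ Icc x (x + η), |FF s u - (γ t).1 0| < η / 7 := by
      intro u hu1
      obtain ⟨r, hr, hr2⟩ := hsub (⟨by have := hu1.1; gcongr, by have := hu1.2; gcongr⟩ :
        u / s ^ n ∈ Icc (x / s ^ n) ((x + η) / s ^ n))
      have h1 := invLim_iter (γ r) 0 n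
      simp only at hr2
      rw [zero_add, hr2, ← C.FF_eq (by linarith [hmono n hn, hu1.2])] at h1
      rw [h1]
      refine hu r t ?_
      rw [abs_sub_comm]
      refine le_trans ?_ htt
      have := abs_sub_left_of_mem_uIcc hr
      rw [abs_sub_comm t t', abs_sub_comm t r]
      exact this
    have h1 := aux u hu1
    have h2 := aux v hv1
    rw [abs_sub_comm] at h2
    have := abs_sub_le (FF s u) ((γ t).1 0) (FF s v)
    linarith
  have hcon : ∀ n, ContinuousOn (fun r => (γ r).1 n) (uIcc t t') := fun n =>
    ((coord_cont s n).comp hc).continuousOn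
  have hval : ∀ n, n0 ≤ n → (γ t).1 n = a / s ^ n := by
    intro n hn
    rw [hγ, C.phi_apply ha, C.GG_small n ha]
    have := hmono (n + 1) (by omega)
    linarith
  have hbd : ∀ n, n0 ≤ n → |a - s ^ n * (γ t').1 n| ≤ η := by
    intro n hn
    have hp := C.pw n
    have hivt := intermediate_value_uIcc (hcon n)
    simp only [hval n hn] at hivt
    by_contra hlt
    push Not at hlt
    rcases lt_abs.1 hlt with h1 | h1
    · have hx : 0 ≤ a - η := by
        have := mul_nonneg hp.le ((γ t').2.1 n).1
        linarith
      refine key n hn (a - η) hx (by linarith) (Subset.trans ?_ hivt)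
      have h3 : (γ t').1 n ≤ (a - η) / s ^ n := by
        rw [le_div_iff₀ hp]; linarith
      have h4 : (γ t').1 n ≤ a / s ^ n := h3.trans (by gcongr; linarith)
      rw [uIcc_of_ge h4, sub_add_cancel]
      exact Icc_subset_Icc h3 le_rfl
    · refine key n hn a ha (by linarith) (Subset.trans ?_ hivt)
      have h3 : (a + η) / s ^ n ≤ (γ t').1 n := by
        rw [div_le_iff₀ hp]; linarith
      have h4 : a / s ^ n ≤ (γ t').1 n := le_trans (by gcongr; linarith) h3
      rw [uIcc_of_le h4]
      exact Icc_subset_Icc le_rfl h3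
  refine ⟨s ^ n0 * (γ t').1 n0, mul_nonneg (C.pw _).le ((γ t').2.1 n0).1,
    C.phi_of_bdd _ (a + η) n0 hn0 ?_, hbd n0 le_rfl⟩
  intro n hn
  have := (abs_le.1 (hbd n hn)).1
  linarith

lemma lift (C : Ctx s ε) (h : invLim s ≃ₜ invLim s) {p : ℝ → invLim s} {L : ℝ} (hL : 0 < L)
    (hp : ∀ k t t', |(p t).1 k - (p t').1 k| ≤ L * |t - t'|) {t0 a : ℝ} (ha : 0 ≤ a)
    (h0 : h (p t0) = C.phi a) :
    ∃ α : ℝ → ℝ, (∀ t, 0 ≤ α t) ∧ (∀ t, h (p t) = C.phi (α t)) ∧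
      ∀ η, 0 < η → ∃ δ, 0 < δ ∧ ∀ t t', |t - t'| ≤ δ → |α t - α t'| ≤ η := by
  have hpc : Continuous p := by
    refine Continuous.subtype_mk (continuous_pi fun k => ?_) _
    have : LipschitzWith ⟨L, hL.le⟩ (fun t => (p t).1 k) :=
      LipschitzWith.of_dist_le_mul (fun x y => by rw [Real.dist_eq, Real.dist_eq]; exact hp k x y)
    exact this.continuous
  have hγ : Continuous (fun t => h (p t)) := h.continuous.comp hpc
  have hu : ∀ η : ℝ, 0 < η → ∃ δ, 0 < δ ∧ ∀ t t', |t - t'| ≤ δ →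
      |(h (p t)).1 0 - (h (p t')).1 0| < η := by
    intro η hη
    obtain ⟨n, hn⟩ := unif_K ((coord_cont s 0).comp h.continuous) hη
    refine ⟨1 / ((n : ℝ) + 1) / L, by positivity, fun t t' htt => hn _ _ fun k _ => ?_⟩
    refine (hp k t t').trans ?_
    rw [le_div_iff₀ hL] at htt
    linarith
  have hex : ∀ t, ∃ a, 0 ≤ a ∧ h (p t) = C.phi a := by
    have hε := C.eps_pos
    obtain ⟨δ, hδ, hd⟩ := hu (ε / 2 / 7) (by linarith)
    have key : ∀ n : ℕ, ∀ t, |t0 - t| ≤ n * δ → ∃ a, 0 ≤ a ∧ h (p t) = C.phi a := by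
      intro n
      induction n with
      | zero =>
        intro t ht
        have : t0 = t := by
          have h1 : |t0 - t| ≤ 0 := by simpa using ht
          have := abs_nonpos_iff.1 h1; linarith
        exact ⟨a, ha, this ▸ h0⟩
      | succ n ih =>
        intro t ht
        push_cast at ht
        have hpos : (0 : ℝ) < (n : ℝ) + 1 := by positivity
        have e1 : |t0 - t| / (n + 1) ≤ δ := by rw [div_le_iff₀ hpos]; linarith
        obtain ⟨a1, ha1, h1⟩ := ih (t0 + (t - t0) * (n / (n + 1))) (by
          have : t0 - (t0 + (t - t0) * ((n : ℝ) / (n + 1))) = n * ((t0 - t) / (n + 1)) := by ring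
          rw [this, abs_mul, abs_div, abs_of_pos hpos, abs_of_nonneg (Nat.cast_nonneg n)]
          gcongr)
        obtain ⟨a2, ha2, h2, _⟩ := C.lift_step hγ (η := ε / 2) (by linarith) (by linarith) hd ha1 h1
          (t' := t) (by
            have : t0 + (t - t0) * ((n : ℝ) / (n + 1)) - t = (t0 - t) / (n + 1) := by
              field_simp; ring
            rw [this, abs_div, abs_of_pos hpos]; exact e1)
        exact ⟨a2, ha2, h2⟩
    intro t
    obtain ⟨n, hn⟩ := exists_nat_ge (|t0 - t| / δ)
    exact key n t ((div_le_iff₀ hδ).1 hn)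
  choose α hα0 hα using hex
  refine ⟨α, hα0, hα, fun η hη => ?_⟩
  have hm : 0 < min η (ε / 2) := lt_min hη (by linarith [C.eps_pos])
  obtain ⟨δ, hδ, hd⟩ := hu (min η (ε / 2) / 7) (by linarith)
  refine ⟨δ, hδ, fun t t' htt => ?_⟩
  obtain ⟨a', ha', h1, h2⟩ := C.lift_step hγ hm
    (lt_of_le_of_lt (min_le_right _ _) (by linarith [C.eps_pos])) hd (hα0 t) (hα t) htt
  have : a' = α t' := C.phi_inj ha' (hα0 t') (h1.symm.trans (hα t'))
  rw [← this]
  exact h2.trans (min_le_left _ _)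

end Ctx

lemma cont_of_unif {α : ℝ → ℝ}
    (h : ∀ η, 0 < η → ∃ δ, 0 < δ ∧ ∀ t t', |t - t'| ≤ δ → |α t - α t'| ≤ η) : Continuous α := by
  rw [Metric.continuous_iff]
  intro b e he
  obtain ⟨δ, hδ, hd⟩ := h (e / 2) (by linarith)
  refine ⟨δ, hδ, fun a ha => ?_⟩
  have := hd a b ha.le
  rw [Real.dist_eq]; linarith

/-- Applying an iterate of the tent map to every coordinate. -/
lemma push_mem {s : ℝ} (hs : 0 < s) (hs2 : s < 2) {q : ℕ → ℝ} (hq : q ∈ invLim s) (m : ℕ) :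
    (fun k => (tent s)^[m] (q k)) ∈ invLim s := by
  induction m with
  | zero => exact hq
  | succ m ih =>
    refine ⟨fun n => ?_, fun n => ?_⟩
    · simp only [iterate_succ_apply']; exact tent_mem hs hs2 (ih.1 n)
    · simp only [iterate_succ_apply']; exact congrArg (tent s) (ih.2 n)

namespace Ctx
variable {s ε : ℝ}

/-- Signs of the slopes along the backward orbit. -/
def sgn (x : ℕ → ℝ) : ℕ → ℝ
  | 0 => 1
  | n + 1 => if x (n + 1) ≤ 1 / 2 then sgn x n else -sgn x n

lemma sgn_abs (x : ℕ → ℝ) (n : ℕ) : |sgn x n| = 1 := by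
  induction n with
  | zero => simp [sgn]
  | succ n ih =>
    unfold sgn
    split_ifs
    · exact ih
    · rw [abs_neg]; exact ih

/-- Choice of the level from which the backward orbit stays on monotone branches. -/
lemma exists_branch (C : Ctx s ε) (x : invLim s) (hx : x ≠ C.phi 0) :
    ∃ m : ℕ, ∃ η : ℝ, 0 < η ∧ η ≤ x.1 m ∧ η ≤ 1 - s / 2 ∧
      ∀ j, 1 ≤ j → η / s ^ j ≤ |x.1 (m + j) - 1 / 2| := by
  have hε := C.eps_pos
  have hs2 := C.lt_two
  obtain ⟨m0, hm0⟩ : ∃ m, x.1 m ≠ 0 := by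
    by_contra hcon
    push Not at hcon
    apply hx
    apply Subtype.ext
    funext k
    rw [hcon, C.phi_apply le_rfl, C.GG_small k le_rfl (by have := C.pw (k + 1); positivity), zero_div]
  have hpos : ∀ j, 0 < x.1 (m0 + j) := by
    intro j
    refine lt_of_le_of_ne (x.2.1 _).1 fun h => hm0 ?_
    rw [← invLim_iter x m0 j, ← h]
    refine iterate_fixed ?_ j
    rw [tent_left C.pos (by norm_num), mul_zero]
  have main : ∀ m, 0 < x.1 m → ∀ e, 0 < e → (∀ j, 1 ≤ j → e / s ^ j ≤ |x.1 (m + j) - 1 / 2|) →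
      ∃ m : ℕ, ∃ η : ℝ, 0 < η ∧ η ≤ x.1 m ∧ η ≤ 1 - s / 2 ∧
      ∀ j, 1 ≤ j → η / s ^ j ≤ |x.1 (m + j) - 1 / 2| := by
    intro m hm e he h
    refine ⟨m, min e (min (x.1 m) (1 - s / 2)), lt_min he (lt_min hm (by linarith)),
      (min_le_right _ _).trans (min_le_left _ _), (min_le_right _ _).trans (min_le_right _ _), ?_⟩
    intro j hj
    refine le_trans ?_ (h j hj)
    have := C.pw j
    gcongr
    exact min_le_left _ _
  by_cases hb : ∀ j, 1 ≤ j → (ε / 4) / s ^ j ≤ |x.1 (m0 + j) - 1 / 2|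
  · exact main m0 (hpos 0) _ (by linarith) hb
  · push Not at hb
    obtain ⟨j, hj, hj2⟩ := hb
    refine main (m0 + j) (hpos j) (ε / 2) (by linarith) fun i hi => ?_
    by_contra hlt
    push Not at hlt
    have h1 := tent_iter_lip C.pos i (x.1 (m0 + j + i)) (1 / 2)
    rw [invLim_iter] at h1
    have h2 : s ^ i * |x.1 (m0 + j + i) - 1 / 2| < ε / 2 := by
      rw [lt_div_iff₀ (C.pw i)] at hlt; linarith
    have h3 := C.away i hi
    have h4 : ε / 4 / s ^ j ≤ ε / 4 := div_le_self (by linarith) (C.one_le_pw j)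
    have h5 := abs_sub_le ((tent s)^[i] (1 / 2)) (x.1 (m0 + j)) (1 / 2)
    rw [abs_sub_comm ((tent s)^[i] (1 / 2)) (x.1 (m0 + j))] at h5
    linarith

/-- Through every point other than `0̄` there is an injective path with the point inside. -/
lemma exists_path (C : Ctx s ε) (x : invLim s) (hx : x ≠ C.phi 0) :
    ∃ p : ℝ → invLim s, ∃ L η : ℝ, 0 < L ∧ 0 < η ∧
      (∀ k t t', |(p t).1 k - (p t').1 k| ≤ L * |t - t'|) ∧ p 0 = x ∧
      InjOn p (Icc (-η) η) := by
  obtain ⟨m, η, hη, hη1, hη2, hη3⟩ := C.exists_branch x hx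
  have hs2 := C.lt_two
  have hs := C.pos
  set X : ℕ → ℝ := fun n => x.1 (m + n) with hX
  set cl : ℝ → ℝ := fun t => max (-η) (min t η) with hcl
  have hcl1 : ∀ t, -η ≤ cl t ∧ cl t ≤ η := fun t =>
    ⟨le_max_left _ _, max_le (by linarith) (min_le_right _ _)⟩
  have hcl2 : ∀ t ∈ Icc (-η) η, cl t = t := fun t ht => by
    simp only [hcl]; rw [min_eq_left ht.2, max_eq_right ht.1]
  have hcl3 : ∀ t t', |cl t - cl t'| ≤ |t - t'| := by
    intro t t'
    refine (abs_max_sub_max_le_max _ _ _ _).trans ?_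
    rw [sub_self, abs_zero]
    refine max_le (abs_nonneg _) ((abs_min_sub_min_le_max _ _ _ _).trans ?_)
    rw [sub_self, abs_zero]
    exact max_le le_rfl (abs_nonneg _)
  set q : ℝ → ℕ → ℝ := fun t n => X n + sgn X n * (cl t / s ^ n) with hq
  have hrec : ∀ t n, q t n = tent s (q t (n + 1)) := by
    intro t n
    have hp := C.pw n
    have hp1 := C.pw (n + 1)
    have h1 := hη3 (n + 1) (by omega)
    have h2 : |sgn X (n + 1) * (cl t / s ^ (n + 1))| ≤ |X (n + 1) - 1 / 2| := by
      rw [abs_mul, sgn_abs, one_mul, abs_div, abs_of_pos hp1]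
      refine le_trans ?_ h1
      gcongr
      exact abs_le.2 (hcl1 t)
    have h3 := abs_le.1 h2
    have hXn : X n = tent s (X (n + 1)) := x.2.2 (m + n)
    have e : s * (cl t / s ^ (n + 1)) = cl t / s ^ n := by
      rw [pow_succ]; field_simp
    simp only [hq]
    by_cases hle : X (n + 1) ≤ 1 / 2
    · rw [abs_of_nonpos (by linarith)] at h3
      rw [tent_left hs (by linarith [h3.2]), hXn, tent_left hs hle, mul_add]
      have : sgn X (n + 1) = sgn X n := by simp only [sgn]; rw [if_pos hle]
      rw [this, mul_left_comm, e]
    · have hle' : 1 / 2 ≤ X (n + 1) := (not_le.1 hle).le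
      rw [abs_of_nonneg (by linarith)] at h3
      rw [tent_right hs (by linarith [h3.1]), hXn, tent_right hs hle']
      have : sgn X (n + 1) = -sgn X n := by simp only [sgn]; rw [if_neg hle]
      rw [this, ← e]; ring
  have hqm : ∀ t, q t ∈ invLim s := by
    intro t
    refine ⟨fun n => ?_, hrec t⟩
    induction n with
    | zero =>
      simp only [hq, sgn, hX, add_zero, pow_zero, div_one, one_mul]
      have := C.coord_le x m
      constructor <;> linarith [(hcl1 t).1, (hcl1 t).2]
    | succ n ih =>
      have h1 := ih.1
      rw [hrec, tent_eq hs] at h1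
      have h2 : |q t (n + 1) - 1 / 2| ≤ 1 / 2 := by
        by_contra hcon
        push Not at hcon
        nlinarith
      rw [abs_le] at h2
      constructor <;> linarith [h2.1, h2.2]
  refine ⟨fun t => ⟨_, push_mem hs hs2 (hqm t) m⟩, s ^ m, η, C.pw m, hη, ?_, ?_, ?_⟩
  · intro k t t'
    refine (tent_iter_lip hs m _ _).trans ?_
    refine mul_le_mul_of_nonneg_left ?_ (C.pw m).le
    have : q t k - q t' k = sgn X k * ((cl t - cl t') / s ^ k) := by simp only [hq]; ring
    rw [this, abs_mul, sgn_abs, one_mul, abs_div, abs_of_pos (C.pw k)]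
    exact (div_le_self (abs_nonneg _) (C.one_le_pw k)).trans (hcl3 t t')
  · apply Subtype.ext
    funext k
    have : q 0 k = x.1 (k + m) := by
      simp only [hq]
      rw [hcl2 0 ⟨by linarith, hη.le⟩, zero_div, mul_zero, add_zero, add_comm k m]
    show (tent s)^[m] (q 0 k) = x.1 k
    rw [this, invLim_iter]
  · intro t ht t' ht' h
    have h1 := congrFun (congrArg Subtype.val h) m
    have h2 : ∀ t, (tent s)^[m] (q t m) = q t 0 := by
      intro t
      have := invLim_iter (⟨q t, hqm t⟩ : invLim s) 0 m
      simpa using this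
    simp only [h2] at h1
    simp only [hq, sgn, pow_zero, div_one, one_mul] at h1
    rw [hcl2 t ht, hcl2 t' ht'] at h1
    linarith

lemma fix_zero (C : Ctx s ε) (h : invLim s ≃ₜ invLim s) : h (C.phi 0) = C.phi 0 := by
  by_contra hne
  obtain ⟨p, L, η, hL, hη, hp, hp0, hinj⟩ := C.exists_path _ hne
  have h0 : h.symm (p 0) = C.phi 0 := by rw [hp0, h.symm_apply_apply]
  obtain ⟨α, hα0, hα, hαu⟩ := C.lift h.symm hL hp le_rfl h0
  have hc := cont_of_unif hαu
  have hz : α 0 = 0 := C.phi_inj (hα0 0) le_rfl ((hα 0).symm.trans h0)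
  have hi : InjOn α (Icc (-η) η) := by
    intro t ht u hu htu
    apply hinj ht hu
    apply h.symm.injective
    rw [hα, hα, htu]
  rcases hc.continuousOn.strictMonoOn_of_injOn_Icc' (by linarith : -η ≤ η) hi with hm | hm
  · have := hm (a := -η) (b := 0) ⟨le_rfl, by linarith⟩ ⟨by linarith, hη.le⟩ (by linarith)
    linarith [hα0 (-η)]
  · have := hm (a := 0) (b := η) ⟨by linarith, hη.le⟩ ⟨by linarith, le_rfl⟩ hη
    linarith [hα0 η]

lemma induced (C : Ctx s ε) (h : invLim s ≃ₜ invLim s) :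
    ∃ g : ℝ → ℝ, (∀ t, 0 ≤ g t) ∧ (∀ t, h (C.phi t) = C.phi (g t)) ∧
      ∀ η, 0 < η → ∃ δ, 0 < δ ∧ ∀ t t', |t - t'| ≤ δ → |g t - g t'| ≤ η :=
  C.lift h one_pos (fun k t t' => C.phi_lip k t t') le_rfl (C.fix_zero h)

lemma mk_half (C : Ctx s ε) (h : invLim s ≃ₜ invLim s) {g g' : ℝ → ℝ} (g0 : ∀ t, 0 ≤ g t)
    (hg : ∀ t, h (C.phi t) = C.phi (g t))
    (gu : ∀ η, 0 < η → ∃ δ, 0 < δ ∧ ∀ t t', |t - t'| ≤ δ → |g t - g t'| ≤ η)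
    (g0' : ∀ t, 0 ≤ g' t) (hg' : ∀ t, h.symm (C.phi t) = C.phi (g' t)) : Half s g g' := by
  have hc := cont_of_unif gu
  have hz : g 0 = 0 := C.phi_inj (g0 0) le_rfl ((hg 0).symm.trans (C.fix_zero h))
  have hl : ∀ t, 0 ≤ t → g' (g t) = t := by
    intro t ht
    apply C.phi_inj (g0' _) ht
    rw [← hg', ← hg, h.symm_apply_apply]
  have hmax : ∀ t, g (max t 0) = g t := by
    intro t
    apply C.phi_inj (g0 _) (g0 _)
    rw [← hg, ← hg, C.phi_max]
  have hmono0 : ∀ t u, 0 ≤ t → t < u → g t ≤ g u := by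
    intro t u ht htu
    have hi : InjOn g (Icc 0 u) := by
      intro a ha b hb hab
      rw [← hl a ha.1, ← hl b hb.1, hab]
    rcases hc.continuousOn.strictMonoOn_of_injOn_Icc' (by linarith : (0 : ℝ) ≤ u) hi with hm | hm
    · exact (hm ⟨ht, htu.le⟩ ⟨by linarith, le_rfl⟩ htu).le
    · have := hm (a := 0) (b := u) ⟨le_rfl, by linarith⟩ ⟨by linarith, le_rfl⟩ (by linarith)
      linarith [g0 u]
  refine ⟨hc, ?_, g0, hz, hl, ?_, ?_⟩
  · intro t u htu
    rw [← hmax t, ← hmax u]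
    rcases eq_or_lt_of_le (max_le_max htu (le_refl (0 : ℝ))) with he | he
    · rw [he]
    · exact hmono0 _ _ (le_max_right _ _) he
  · intro N η hη
    obtain ⟨n, hn⟩ := unif_K ((coord_cont s N).comp h.continuous) hη
    refine ⟨n, fun t u ht hu htu => ?_⟩
    have := hn (C.phi t) (C.phi u) (fun k hk => by
      rw [C.phi_apply ht, C.phi_apply hu, C.GG_eq_of_le hk ht hu htu, sub_self, abs_zero]
      positivity)
    simp only [comp_apply] at this
    rw [hg, hg, C.phi_apply (g0 _), C.phi_apply (g0 _)] at this
    exact this.le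
  · intro η hη
    obtain ⟨δ, hδ, hd⟩ := gu η hη
    exact ⟨δ, hδ, fun t u _ _ htu => hd t u htu⟩

/-- Coordinate estimate for a homeomorphism. -/
lemma estimate (C : Ctx s ε) (h : invLim s ≃ₜ invLim s) :
    ∃ i J : ℕ, ∃ M : ℝ, 0 < M ∧ ∀ z : invLim s, ∀ k : ℕ,
      |(h z).1 (k + i) - z.1 (k + J)| ≤ M / s ^ (k + i) := by
  obtain ⟨g, g0, hg, gu⟩ := C.induced h
  obtain ⟨g', g0', hg', gu'⟩ := C.induced h.symm
  have H := C.mk_half h g0 hg gu g0' hg'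
  have H' := C.mk_half h.symm g0' hg' gu' g0 hg
  obtain ⟨i, J, M, hM, hb⟩ := C.core H H'
  refine ⟨i, J, M, hM, fun z k => ?_⟩
  refine le_of_forall_pos_le_add fun η hη => ?_
  obtain ⟨n, hn⟩ := unif_K ((coord_cont s (k + i)).comp h.continuous) hη
  obtain ⟨t, ht, htz⟩ := C.phi_dense z (max n (k + J))
  have h1 := hn (C.phi t) z (fun l hl => by
    rw [htz l (hl.trans (le_max_left _ _)), sub_self, abs_zero]; positivity)
  simp only [comp_apply] at h1
  have h2 := htz (k + J) (le_max_right _ _)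
  rw [hg, C.phi_apply (g0 t)] at h1
  rw [C.phi_apply ht] at h2
  have h3 : GG s (k + J) t = GG s (k + i) (s ^ i / s ^ J * t) := by
    unfold GG; congr 1
    have := C.pw i; have := C.pw J; have := C.pw k
    rw [pow_add, pow_add]; field_simp
  have h4 := C.GG_lip (k + i) (g t) (s ^ i / s ^ J * t)
  have h5 : |g t - s ^ i / s ^ J * t| / s ^ (k + i) ≤ M / s ^ (k + i) := by
    have := C.pw (k + i)
    gcongr
    exact hb t ht
  rw [← h3, h2] at h4
  have h6 := abs_sub_le ((h z).1 (k + i)) (GG s (k + i) (g t)) (z.1 (k + J))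
  rw [abs_sub_comm ((h z).1 (k + i)) (GG s (k + i) (g t))] at h6
  linarith

/-- Two points with exponentially close coordinates lie on a common short arc. -/
lemma arc_of_close (C : Ctx s ε) {x y : invLim s} {M : ℝ} (hM : 0 < M) {k0 : ℕ}
    (h : ∀ k, k0 ≤ k → |x.1 k - y.1 k| ≤ M / s ^ k) :
    ∃ A : Set (invLim s), IsArcOrPoint A ∧ x ∈ A ∧ y ∈ A ∧
      ∃ m : ℕ, InjOn (proj s m) A ∧ s ^ m * Metric.diam (proj s m '' A) ≤ M := by
  have hs := C.pos
  have hs2 := C.lt_two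
  have hε := C.eps_pos
  obtain ⟨m, hm, hside⟩ : ∃ m, k0 ≤ m ∧
      ∀ n, m < n → 0 ≤ (x.1 n - 1 / 2) * (y.1 n - 1 / 2) := by
    obtain ⟨n0, hn0⟩ := C.exists_pow (2 * M / ε)
    set k1 := max k0 n0 with hk1
    by_cases hb : ∀ n, k1 < n → 0 ≤ (x.1 n - 1 / 2) * (y.1 n - 1 / 2)
    · exact ⟨k1, le_max_left _ _, hb⟩
    · push Not at hb
      obtain ⟨m, hm, hneg⟩ := hb
      have hk0m : k0 ≤ m := (le_max_left _ _).trans hm.le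
      refine ⟨m, hk0m, fun n hn => ?_⟩
      by_contra hneg2
      push Not at hneg2
      have bad : ∀ k, k0 ≤ k → (x.1 k - 1 / 2) * (y.1 k - 1 / 2) < 0 →
          |x.1 k - 1 / 2| ≤ M / s ^ k := by
        intro k hk hneg
        refine le_trans ?_ (h k hk)
        rcases mul_neg_iff.1 hneg with ⟨h1, h2⟩ | ⟨h1, h2⟩
        · rw [abs_of_pos h1, abs_of_pos (by linarith)]; linarith
        · rw [abs_of_neg h1, abs_of_neg (by linarith)]; linarith
      have b1 := bad m hk0m hneg
      have b2 := bad n (by omega) hneg2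
      obtain ⟨j, rfl⟩ := Nat.exists_eq_add_of_lt hn
      have h1 := tent_iter_lip hs (j + 1) (x.1 (m + (j + 1))) (1 / 2)
      rw [invLim_iter] at h1
      have h2 : s ^ (j + 1) * |x.1 (m + (j + 1)) - 1 / 2| ≤ M / s ^ m := by
        calc _ ≤ s ^ (j + 1) * (M / s ^ (m + (j + 1))) :=
              mul_le_mul_of_nonneg_left b2 (C.pw _).le
          _ = M / s ^ m := by
            rw [pow_add s m (j + 1), div_mul_eq_div_div, mul_div_cancel₀ _ (C.pw (j + 1)).ne']
      have h3 := C.away (j + 1) (by omega)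
      have h4 := abs_sub_le ((tent s)^[j + 1] (1 / 2)) (x.1 m) (1 / 2)
      rw [abs_sub_comm ((tent s)^[j + 1] (1 / 2)) (x.1 m)] at h4
      have h5 : M / s ^ m < ε / 2 := by
        have e1 : s ^ n0 ≤ s ^ m := pow_le_pow_right₀ C.one_lt.le ((le_max_right k0 n0).trans hm.le)
        rw [div_le_iff₀ hε] at hn0
        rw [div_lt_iff₀ (C.pw m)]
        nlinarith
      linarith
  have hxm : s ^ m * |x.1 m - y.1 m| ≤ M := by
    have := h m hm
    rw [le_div_iff₀ (C.pw m)] at this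
    linarith
  by_cases hne : x.1 m = y.1 m
  · have hxy : x = y := by
      apply invLim_eq_of_ge m
      intro n
      induction n with
      | zero => exact hne
      | succ n ih =>
        have h1 := hside (m + (n + 1)) (by omega)
        have h2 := tent_diff hs (x.1 (m + n + 1)) (y.1 (m + n + 1))
        rw [← x.2.2, ← y.2.2, ih, sub_self, abs_zero] at h2
        have h3 := (mul_eq_zero.1 h2.symm).resolve_left hs.ne'
        rw [abs_eq_zero] at h3
        rw [← add_assoc] at h1 ⊢
        rcases mul_nonneg_iff.1 h1 with ⟨a, b⟩ | ⟨a, b⟩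
        · rw [abs_of_nonneg a, abs_of_nonneg b] at h3; linarith
        · rw [abs_of_nonpos a, abs_of_nonpos b] at h3; linarith
    refine ⟨{x}, Or.inr ⟨x, rfl⟩, rfl, hxy.symm, m, injOn_singleton _ _, ?_⟩
    rw [image_singleton, Metric.diam_singleton, mul_zero]
    exact hM.le
  · set q : ℝ → ℕ → ℝ := fun r n => x.1 (m + n) + r * (y.1 (m + n) - x.1 (m + n)) with hq
    have hqm : ∀ r ∈ Icc (0 : ℝ) 1, q r ∈ invLim s := by
      intro r hr
      refine ⟨fun n => ?_, fun n => ?_⟩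
      · have := x.2.1 (m + n)
        have := y.2.1 (m + n)
        have hc := (convex_Icc (0 : ℝ) 1) (x.2.1 (m + n)) (y.2.1 (m + n))
          (by linarith [hr.2] : 0 ≤ 1 - r) hr.1 (by ring)
        have e : q r n = (1 - r) • x.1 (m + n) + r • y.1 (m + n) := by
          simp only [hq, smul_eq_mul]; ring
        rw [e]; exact hc
      · have h1 := hside (m + (n + 1)) (by omega)
        have ex : x.1 (m + n) = tent s (x.1 (m + (n + 1))) := x.2.2 (m + n)
        have ey : y.1 (m + n) = tent s (y.1 (m + (n + 1))) := y.2.2 (m + n)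
        simp only [hq]
        rw [ex, ey]
        rcases mul_nonneg_iff.1 h1 with ⟨a, b⟩ | ⟨a, b⟩
        · rw [tent_right hs (by linarith), tent_right hs (by linarith), tent_right hs]
          · ring
          · nlinarith [hr.1, hr.2, mul_nonneg hr.1 b,
              mul_nonneg (by linarith [hr.2] : 0 ≤ 1 - r) a]
        · rw [tent_left hs (by linarith), tent_left hs (by linarith), tent_left hs]
          · ring
          · nlinarith [hr.1, hr.2, mul_nonneg hr.1 (neg_nonneg.2 b),
              mul_nonneg (by linarith [hr.2] : 0 ≤ 1 - r) (neg_nonneg.2 a)]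
    set P : unitInterval → invLim s := fun r => ⟨_, push_mem hs hs2 (hqm r.1 r.2) m⟩ with hP
    have hPm : ∀ r : unitInterval, proj s m (P r) = x.1 m + r.1 * (y.1 m - x.1 m) := by
      intro r
      have := invLim_iter (⟨q r.1, hqm r.1 r.2⟩ : invLim s) 0 m
      rw [zero_add] at this
      exact this
    have hPc : Continuous P := by
      refine Continuous.subtype_mk (continuous_pi fun k => ?_) _
      refine ((tent_cont s).iterate m).comp ?_
      simp only [hq]
      fun_prop
    have hinj : ∀ r r' : unitInterval, proj s m (P r) = proj s m (P r') → r = r' := by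
      intro r r' h
      rw [hPm, hPm] at h
      apply Subtype.ext
      have h1 : (r.1 - r'.1) * (y.1 m - x.1 m) = 0 := by linarith
      rcases mul_eq_zero.1 h1 with h2 | h2
      · linarith
      · exact absurd (by linarith) hne
    have hPi : Injective P := fun r r' h => hinj r r' (by rw [h])
    have hP0 : P 0 = x := by
      apply Subtype.ext
      funext k
      show (tent s)^[m] (q 0 k) = x.1 k
      simp only [hq]
      rw [zero_mul, add_zero, add_comm m k, invLim_iter]
    have hP1 : P 1 = y := by
      apply Subtype.ext
      funext k
      show (tent s)^[m] (q 1 k) = y.1 k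
      simp only [hq]
      rw [one_mul, add_sub_cancel, add_comm m k, invLim_iter]
    refine ⟨range P, Or.inl ⟨x, y, P, (hPc.isClosedEmbedding hPi).isEmbedding, rfl, hP0, hP1⟩,
      ⟨0, hP0⟩, ⟨1, hP1⟩, m, ?_, ?_⟩
    · rintro _ ⟨r, rfl⟩ _ ⟨r', rfl⟩ h
      rw [hinj r r' h]
    · refine le_trans (mul_le_mul_of_nonneg_left ?_ (C.pw m).le) hxm
      apply Metric.diam_le_of_forall_dist_le (abs_nonneg _)
      rintro _ ⟨_, ⟨r, rfl⟩, rfl⟩ _ ⟨_, ⟨r', rfl⟩, rfl⟩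
      rw [hPm, hPm, Real.dist_eq]
      have e : x.1 m + r.1 * (y.1 m - x.1 m) - (x.1 m + r'.1 * (y.1 m - x.1 m)) =
        (r'.1 - r.1) * (x.1 m - y.1 m) := by ring
      rw [e, abs_mul]
      refine mul_le_of_le_one_left (abs_nonneg _) ?_
      rw [abs_le]
      constructor <;> linarith [r.2.1, r.2.2, r'.2.1, r'.2.2]

end Ctx

lemma fwd_iter {s : ℝ} (hs1 : Real.sqrt 2 < s) (hs2 : s < 2) (n : ℕ) (z : invLim s) (k : ℕ) :
    ((shiftFwdFun s hs1 hs2)^[n] z).1 (k + n) = z.1 k := by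
  induction n generalizing z k with
  | zero => rfl
  | succ n ih =>
    rw [iterate_succ_apply', ← add_assoc]
    exact ih z k

lemma inv_iter {s : ℝ} (n : ℕ) (z : invLim s) (k : ℕ) :
    ((shiftInvFun s)^[n] z).1 k = z.1 (k + n) := by
  induction n generalizing z k with
  | zero => rfl
  | succ n ih =>
    rw [iterate_succ_apply']
    show ((shiftInvFun s)^[n] z).1 (k + 1) = _
    rw [ih, add_assoc, add_comm 1 n]

lemma shiftZ_coord {s : ℝ} (hs1 : Real.sqrt 2 < s) (hs2 : s < 2) (i J : ℕ) (z : invLim s) (k : ℕ) :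
    (shiftZ s hs1 hs2 ((i : ℤ) - J) z).1 (k + i) = z.1 (k + J) := by
  unfold shiftZ
  split_ifs with h
  · have h1 : k + i = (k + J) + ((i : ℤ) - J).toNat := by omega
    rw [h1, fwd_iter]
  · have h1 : k + i + (-((i : ℤ) - J)).toNat = k + J := by omega
    rw [inv_iter, h1]

/-- there are `b : ℤ` and `M > 0` such that `d̄(σ̂^{-b}(z̄), h(z̄)) ≤ M` for all
`z̄ ∈ K`: the two points lie on a common (possibly degenerate) arc of `d̄`-length at most `M`. -/
theorem statement3 (s : ℝ) (hs1 : Real.sqrt 2 < s) (hs2 : s < 2)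
    (hnr : (1 : ℝ) / 2 ∉ omegaSet (tent s) (1 / 2))
    (h : invLim s ≃ₜ invLim s) :
    ∃ b : ℤ, ∃ M : ℝ, 0 < M ∧ ∀ z : invLim s, ∃ A : Set (invLim s),
      IsArcOrPoint A ∧ h z ∈ A ∧ shiftZ s hs1 hs2 (-b) z ∈ A ∧
      ∃ m : ℕ, InjOn (proj s m) A ∧ s ^ m * Metric.diam (proj s m '' A) ≤ M := by
  obtain ⟨ε, C⟩ := exists_ctx s hs1 hs2 hnr
  obtain ⟨i, J, M, hM, hest⟩ := C.estimate h
  refine ⟨(J : ℤ) - i, M, hM, fun z => ?_⟩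
  refine C.arc_of_close hM (k0 := i) fun k hk => ?_
  obtain ⟨k, rfl⟩ := Nat.exists_eq_add_of_le' hk
  rw [neg_sub, shiftZ_coord]
  exact hest z k
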